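/- arXiv:2604.19437 — 6 statements merged into one kernel-verified Lean document; each statement's English description precedes it below -/
import Mathlib

section
/- Let Q be a positive definite integral quadratic form in 4 variables. There exists a constant κ ≥ 1, depending only on Q, such that for every primitive vector v ∈ ℤ⁴ (i.e. the gcd of its coordinates is 1), writing W = {w ∈ ℚ⁴ : ⟨v,w⟩_Q = 0} for the orthogonal complement of v, one has Q(v)/κ ≤ disc(Q|_{W(ℤ)}) ≤ κ·Q(v). -/
open Matrix

/-- `M` is the Gram matrix of a positive definite integral quadratic form in `n` variables. -/
def IsIntegralPosDefForm {n : ℕ} (M : Matrix (Fin n) (Fin n) ℚ) : Prop :=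
  M.IsSymm ∧ (∀ i, ∃ z : ℤ, M i i = z) ∧ (∀ i j, ∃ z : ℤ, 2 * M i j = z) ∧
    ∀ v : Fin n → ℚ, v ≠ 0 → 0 < v ⬝ᵥ M.mulVec v

theorem det_pos_of_rat_form_pos {n : ℕ} (M : Matrix (Fin n) (Fin n) ℚ) (hs : M.IsSymm)
    (hp : ∀ v : Fin n → ℚ, v ≠ 0 → 0 < v ⬝ᵥ M.mulVec v) : 0 < M.det := by
  have hne : M.det ≠ 0 := by
    intro h
    obtain ⟨v, hv, hv0⟩ := Matrix.exists_mulVec_eq_zero_iff.mpr h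
    have := hp v hv
    simp [hv0] at this
  have hnonneg : ∀ v : Fin n → ℚ, 0 ≤ v ⬝ᵥ M.mulVec v := by
    intro v
    rcases eq_or_ne v 0 with rfl | hv
    · simp
    · exact (hp v hv).le
  let R : Matrix (Fin n) (Fin n) ℝ := M.map (Rat.castHom ℝ)
  have hR : R.PosSemidef := by
    refine .of_dotProduct_mulVec_nonneg ?_ ?_
    · ext i j
      simpa [R] using congrArg (Rat.cast : ℚ → ℝ) (hs.apply i j)
    · intro x
      have hd : DenseRange (Pi.map fun (_ : Fin n) => ((↑) : ℚ → ℝ)) :=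
        DenseRange.piMap fun _ => Rat.denseRange_cast
      refine hd.induction_on (p := fun x => 0 ≤ star x ⬝ᵥ R.mulVec x) x ?_ ?_
      · refine isClosed_le continuous_const ?_
        simp only [dotProduct, Matrix.mulVec, Pi.star_apply, star_trivial]
        fun_prop
      · intro v
        have h : ((v ⬝ᵥ M.mulVec v : ℚ) : ℝ) = star (Pi.map (fun _ => ((↑) : ℚ → ℝ)) v) ⬝ᵥ
            R.mulVec (Pi.map (fun _ => ((↑) : ℚ → ℝ)) v) := by
          simp [dotProduct, Matrix.mulVec, R]
        rw [← h]
        exact_mod_cast hnonneg v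
  have h0 := hR.det_nonneg
  have hdet : R.det = (M.det : ℝ) := ((Rat.castHom ℝ).map_det M).symm
  rw [hdet] at h0
  exact lt_of_le_of_ne (by exact_mod_cast h0) hne.symm

/-- If every row of `u` is orthogonal to `v`, the Gram determinant of `v, u₁, …, uₙ` splits. -/
theorem det_cons_sq_mul_det {n : ℕ} (M : Matrix (Fin (n + 1)) (Fin (n + 1)) ℚ)
    (v : Fin (n + 1) → ℚ) (u : Fin n → Fin (n + 1) → ℚ)
    (h : ∀ a, v ⬝ᵥ M.mulVec (u a) = 0) :
    (Matrix.of (Fin.cons v u : Fin (n + 1) → Fin (n + 1) → ℚ)).det ^ 2 * M.det =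
      (v ⬝ᵥ M.mulVec v) * (Matrix.of fun a b => (u a) ⬝ᵥ M.mulVec (u b)).det := by
  set A := Matrix.of (Fin.cons v u : Fin (n + 1) → Fin (n + 1) → ℚ)
  have hA0 : A 0 = v := rfl
  have hAs : ∀ a, A (Fin.succ a) = u a := fun _ => rfl
  have hP : ∀ i j, (A * M * Aᵀ) i j = A i ⬝ᵥ M.mulVec (A j) := by
    intro i j
    rw [Matrix.mul_assoc, Matrix.mul_apply_eq_vecMul, Matrix.vecMul, dotProduct]
    rfl
  have hdet : (A * M * Aᵀ).det = A.det ^ 2 * M.det := by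
    rw [Matrix.det_mul, Matrix.det_mul, Matrix.det_transpose]; ring
  rw [← hdet, Matrix.det_succ_row_zero, Fin.sum_univ_succ, Finset.sum_eq_zero]
  · have hsub : (A * M * Aᵀ).submatrix Fin.succ (Fin.succAbove 0) =
        Matrix.of fun a b => (u a) ⬝ᵥ M.mulVec (u b) := by
      ext a b
      simp [hP, hAs]
    rw [hsub, hP, hA0]
    simp
  · intro j _
    have : (A * M * Aᵀ) 0 j.succ = 0 := by
      rw [hP, hA0, hAs, h j]
    simp [this]

/-- A `ℤ`-basis of the kernel of a primitive functional `p` has unit index, so prepending `v`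
gives determinant `± p ⬝ v`. -/
theorem det_cons_sq_eq_dotProduct_sq {n : ℕ} (p x : Fin (n + 1) → ℤ) (hpx : p ⬝ᵥ x = 1)
    (u : Fin n → Fin (n + 1) → ℤ)
    (hspan : ∀ w, p ⬝ᵥ w = 0 → ∃ c : Fin n → ℤ, w = ∑ a, c a • u a)
    (v : Fin (n + 1) → ℤ) :
    (Matrix.of (Fin.cons v u : Fin (n + 1) → Fin (n + 1) → ℤ)).det ^ 2 = (p ⬝ᵥ v) ^ 2 := by
  set U := Matrix.of (Fin.cons x u : Fin (n + 1) → Fin (n + 1) → ℤ) with hU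
  have hU0 : U 0 = x := rfl
  have hUs : ∀ a, U (Fin.succ a) = u a := fun _ => rfl
  have hcoef : ∀ w, ∃ k : Fin (n + 1) → ℤ, k 0 = p ⬝ᵥ w ∧ w = ∑ i, k i • U i := by
    intro w
    obtain ⟨c, hc⟩ := hspan (w - (p ⬝ᵥ w) • x) 
      (by rw [dotProduct_sub, dotProduct_smul, hpx, smul_eq_mul, mul_one, sub_self])
    refine ⟨Fin.cons (p ⬝ᵥ w) c, rfl, ?_⟩
    rw [Fin.sum_univ_succ]
    simp only [Fin.cons_zero, Fin.cons_succ, hU0, hUs]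
    rw [← hc, add_sub_cancel]
  have hunit : IsUnit U.det := by
    choose C _ hC using fun i => hcoef (Pi.single i 1)
    have hCU : Matrix.of C * U = 1 := by
      ext i j
      have := congrFun (hC i) j
      rw [Matrix.mul_apply, Matrix.one_eq_pi_single, this]
      simp
    exact IsUnit.of_mul_eq_one _ (by rw [mul_comm, ← Matrix.det_mul, hCU, Matrix.det_one])
  obtain ⟨k, hk0, hk⟩ := hcoef v
  have hv : Matrix.of (Fin.cons v u : Fin (n + 1) → Fin (n + 1) → ℤ) =
      U.updateRow 0 (∑ i, k i • U i) := by
    rw [← hk]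
    ext i j
    refine Fin.cases ?_ (fun i => ?_) i <;> simp [hU, Matrix.updateRow_apply]
  rw [hv, Matrix.det_updateRow_sum, hk0, smul_eq_mul, mul_pow, Int.isUnit_sq hunit, mul_one]

/-- The content of `N v` divides `det N` when `v` is primitive. -/
theorem exists_mulVec_eq_smul_of_gcd_eq_one {n : ℕ} (N : Matrix (Fin (n + 1)) (Fin (n + 1)) ℤ)
    (v : Fin (n + 1) → ℤ) (hv : Finset.univ.gcd v = 1) :
    ∃ (g : ℤ) (p x : Fin (n + 1) → ℤ),
      N.mulVec v = g • p ∧ p ⬝ᵥ x = 1 ∧ g ∣ N.det := by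
  obtain ⟨p, hp, hp1⟩ := Finset.extract_gcd (s := Finset.univ) (N.mulVec v)
    Finset.univ_nonempty
  obtain ⟨x, hx⟩ := Finset.gcd_eq_sum_mul Finset.univ p
  refine ⟨Finset.univ.gcd (N.mulVec v), p, x, ?_, ?_, ?_⟩
  · ext i
    exact hp i (Finset.mem_univ i)
  · rw [← hp1, hx]; rfl
  · have hadj : N.adjugate.mulVec (N.mulVec v) = N.det • v := by
      rw [Matrix.mulVec_mulVec, Matrix.adjugate_mul, Matrix.smul_mulVec, Matrix.one_mulVec]
    have hdvd : ∀ i, Finset.univ.gcd (N.mulVec v) ∣ N.det * v i := by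
      intro i
      have := congrFun hadj i
      simp only [Pi.smul_apply, smul_eq_mul] at this
      rw [← this]
      change _ ∣ ∑ j, N.adjugate i j * N.mulVec v j
      exact Finset.dvd_sum fun j _ => Dvd.dvd.mul_left (Finset.gcd_dvd (Finset.mem_univ j)) _
    obtain ⟨y, hy⟩ := Finset.gcd_eq_sum_mul Finset.univ v
    rw [← mul_one N.det, ← hv, hy, Finset.mul_sum]
    refine Finset.dvd_sum fun i _ => ?_
    rw [← mul_assoc]
    exact (hdvd i).mul_right _


/-- Let `Q` be a positive definite integral quadratic form in 4 variables
with Gram matrix `MQ`.  There is a constant `κ ≥ 1`, depending only on `Q`, such that for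
every primitive vector `v ∈ ℤ⁴`, writing `W = {w ∈ ℚ⁴ : ⟨v,w⟩_Q = 0}` for the orthogonal
complement of `v`, and for every ℤ-basis `u` of `W(ℤ) = W ∩ ℤ⁴`, one has
`Q(v)/κ ≤ disc(Q|_{W(ℤ)}) ≤ κ·Q(v)`. -/
theorem disc_orthocomplement_primitive_vector
    (MQ : Matrix (Fin 4) (Fin 4) ℚ) (hQ : IsIntegralPosDefForm MQ) :
    ∃ κ : ℚ, 1 ≤ κ ∧
      ∀ v : Fin 4 → ℤ, Finset.univ.gcd v = 1 →
        ∀ u : Fin 3 → Fin 4 → ℚ,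
          -- each `u a` lies in `W = v⊥`
          (∀ a, (fun i => (v i : ℚ)) ⬝ᵥ MQ.mulVec (u a) = 0) →
          -- each `u a` is integral
          (∀ a i, ∃ z : ℤ, u a i = z) →
          LinearIndependent ℚ u →
          -- `u` spans `W(ℤ)` over `ℤ`
          (∀ w : Fin 4 → ℚ, (fun i => (v i : ℚ)) ⬝ᵥ MQ.mulVec w = 0 →
            (∀ i, ∃ z : ℤ, w i = z) → ∃ cvec : Fin 3 → ℤ, w = ∑ a, (cvec a : ℚ) • u a) →
          ((fun i => (v i : ℚ)) ⬝ᵥ MQ.mulVec (fun i => (v i : ℚ))) / κ ≤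
              (Matrix.of fun a b => (u a) ⬝ᵥ MQ.mulVec (u b)).det ∧
            (Matrix.of fun a b => (u a) ⬝ᵥ MQ.mulVec (u b)).det ≤
              κ * ((fun i => (v i : ℚ)) ⬝ᵥ MQ.mulVec (fun i => (v i : ℚ))) := by
  obtain ⟨hs, -, hint, hpos⟩ := hQ
  have hD := det_pos_of_rat_form_pos MQ hs hpos
  choose N' hN' using hint
  set N : Matrix (Fin 4) (Fin 4) ℤ := Matrix.of N' with hNdef
  have hN : N.map (Int.castRingHom ℚ) = (2 : ℚ) • MQ := by
    ext i j
    simp [hNdef, hN']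
  have hNdet : (N.det : ℚ) = 16 * MQ.det := by
    have h := (Int.castRingHom ℚ).map_det N
    rw [RingHom.mapMatrix_apply, hN, Matrix.det_smul] at h
    norm_num at h
    exact h
  have hNpos : 0 < N.det := by
    have : (0 : ℚ) < N.det := by rw [hNdet]; positivity
    exact_mod_cast this
  have hD1 : 1 ≤ 16 * MQ.det := by
    rw [← hNdet]; exact_mod_cast hNpos
  refine ⟨64 * MQ.det, by linarith, ?_⟩
  intro v hv u hu huint _ hspan
  obtain ⟨g, p, x, hg, hpx, hgd⟩ := exists_mulVec_eq_smul_of_gcd_eq_one N v hv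
  have hg0 : g ≠ 0 := by
    rintro rfl
    exact hNpos.ne' (zero_dvd_iff.mp hgd)
  choose z hz using huint
  obtain rfl : u = fun a i => (z a i : ℚ) := by
    ext a i
    exact hz a i
  have hpair : ∀ w : Fin 4 → ℤ, 2 * ((fun i => (v i : ℚ)) ⬝ᵥ MQ.mulVec (fun i => (w i : ℚ))) =
      g * ((p ⬝ᵥ w : ℤ) : ℚ) := by
    intro w
    have hgw : (N.mulVec v) ⬝ᵥ w = g * (p ⬝ᵥ w) := by rw [hg, smul_dotProduct, smul_eq_mul]
    rw [← Int.cast_mul, ← hgw, dotProduct_mulVec, ← Matrix.mulVec_transpose, hs.eq]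
    simp only [dotProduct, Matrix.mulVec, Finset.mul_sum, Finset.sum_mul, Int.cast_sum,
      Int.cast_mul, hNdef, Matrix.of_apply, ← hN']
    refine Finset.sum_congr rfl fun i _ => Finset.sum_congr rfl fun j _ => ?_
    ring
  have hdetA := det_cons_sq_eq_dotProduct_sq p x hpx z (fun w hw => by
    obtain ⟨c, hc⟩ := hspan (fun i => (w i : ℚ))
      (by have := hpair w; rw [hw] at this; simpa using this) (fun i => ⟨w i, rfl⟩)
    refine ⟨c, ?_⟩
    ext i
    have := congrFun hc i
    simp only [Finset.sum_apply, Pi.smul_apply, smul_eq_mul] at this ⊢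
    exact_mod_cast this) v
  have hgram := det_cons_sq_mul_det MQ (fun i => (v i : ℚ)) (fun a i => (z a i : ℚ)) hu
  have hcast : (Matrix.of (Fin.cons (fun i => (v i : ℚ)) (fun a i => (z a i : ℚ)) :
      Fin 4 → Fin 4 → ℚ)).det =
      ((Matrix.of (Fin.cons v z : Fin 4 → Fin 4 → ℤ)).det : ℚ) := by
    have h := (Int.castRingHom ℚ).map_det (Matrix.of (Fin.cons v z : Fin 4 → Fin 4 → ℤ))
    rw [eq_intCast] at h
    rw [h]
    congr 1
    ext i j
    refine Fin.cases ?_ (fun i => ?_) i <;> simp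
  have hA : (((Matrix.of (Fin.cons v z : Fin 4 → Fin 4 → ℤ)).det : ℤ) : ℚ) ^ 2 =
      ((p ⬝ᵥ v : ℤ) : ℚ) ^ 2 := by exact_mod_cast hdetA
  rw [hcast, hA] at hgram
  have hc := hpair v
  have hq : 0 < (fun i => (v i : ℚ)) ⬝ᵥ MQ.mulVec (fun i => (v i : ℚ)) := by
    refine hpos _ fun h0 => ?_
    have hv0 : v = 0 := by
      ext i
      simpa using congrFun h0 i
    simp [hv0, Finset.gcd_eq_zero_iff.mpr] at hv
  generalize (fun i => (v i : ℚ)) ⬝ᵥ MQ.mulVec (fun i => (v i : ℚ)) = q at *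
  generalize (Matrix.of fun a b : Fin 3 => (fun i => (z a i : ℚ)) ⬝ᵥ
    MQ.mulVec (fun i => (z b i : ℚ))).det = d at *
  generalize ((p ⬝ᵥ v : ℤ) : ℚ) = c at *
  have hg1 : (1 : ℚ) ≤ (g : ℚ) ^ 2 := by
    have : 0 < g ^ 2 := by positivity
    exact_mod_cast this
  have hg2 : (g : ℚ) ^ 2 ≤ (16 * MQ.det) ^ 2 := by
    rw [← hNdet]
    have := sq_le_sq.mpr (Int.le_of_dvd (abs_pos.mpr hNpos.ne') ((abs_dvd_abs g _).mpr hgd))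
    exact_mod_cast this
  have key : d * (g : ℚ) ^ 2 = 4 * q * MQ.det := by
    refine mul_left_cancel₀ hq.ne' ?_
    linear_combination (-(g : ℚ) ^ 2) * hgram - MQ.det * (2 * q + g * c) * hc
  have hd : 0 < d := by
    have : 0 < d * (g : ℚ) ^ 2 := by rw [key]; positivity
    exact pos_of_mul_pos_left this (by positivity)
  constructor
  · rw [div_le_iff₀ (by positivity)]
    have h := mul_le_mul_of_nonneg_left hg2 hd.le
    rw [key] at h
    refine le_of_mul_le_mul_left ?_ (show 0 < 4 * MQ.det by positivity)
    linarith
  · have h := mul_le_mul_of_nonneg_left hg1 hd.le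
    rw [key] at h
    have : 0 < q * MQ.det := by positivity
    linarith
end

section
/- Let p be an odd prime and let Q be a positive definite integral quadratic form in 4 variables with disc(Q) a p-adic unit. Let q be a binary quadratic form over ℤ_p with disc(q) ∈ ℤ_p^×. If ι₁, ι₂ : ℤ_p² → ℤ_p⁴ are two ℤ_p-linear maps with Q∘ι₁ = q = Q∘ι₂ (i.e. ι_jᵀ·M_Q·ι_j = M_q for j = 1,2), then there exists k ∈ Mat₄(ℤ_p) with kᵀ·M_Q·k = M_Q, det(k) = 1, and k∘ι₁ = ι₂. -/
open Matrix

section Isometries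

variable {R n m : Type*} [CommRing R] [Fintype n]

theorem dotProduct_mulVec_comm_of_isSymm {M : Matrix n n R} (hM : M.IsSymm) (x y : n → R) :
    x ⬝ᵥ M *ᵥ y = y ⬝ᵥ M *ᵥ x := by
  rw [dotProduct_mulVec, ← mulVec_transpose, hM.eq, dotProduct_comm]

/-- The group of matrices preserving the bilinear form with Gram matrix `M`. -/
def IsIsometry (M k : Matrix n n R) : Prop := kᵀ * M * k = M

theorem IsIsometry.mul {M k l : Matrix n n R} (hk : IsIsometry M k) (hl : IsIsometry M l) :
    IsIsometry M (k * l) := by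
  unfold IsIsometry at *
  calc (k * l)ᵀ * M * (k * l) = lᵀ * (kᵀ * M * k) * l := by
        simp only [transpose_mul, Matrix.mul_assoc]
    _ = M := by rw [hk, hl]

theorem IsIsometry.dotProduct {M k : Matrix n n R} (hk : IsIsometry M k) (x y : n → R) :
    (k *ᵥ x) ⬝ᵥ M *ᵥ (k *ᵥ y) = x ⬝ᵥ M *ᵥ y := by
  conv_rhs => rw [← hk]
  simp only [← mulVec_mulVec]
  rw [dotProduct_mulVec x kᵀ, vecMul_transpose]

variable [DecidableEq n]

/-- The matrix of the map `x ↦ x - r ⟨u, x⟩ u`, a reflection when `r ⟨u, u⟩ = 2`. -/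
def reflectionMatrix (M : Matrix n n R) (r : R) (u : n → R) : Matrix n n R :=
  1 - vecMulVec (r • u) (M *ᵥ u)

theorem reflectionMatrix_mulVec {M : Matrix n n R} (hM : M.IsSymm) (r : R) (u x : n → R) :
    reflectionMatrix M r u *ᵥ x = x - (r * (u ⬝ᵥ M *ᵥ x)) • u := by
  rw [dotProduct_mulVec_comm_of_isSymm hM u x, dotProduct_comm x, reflectionMatrix, sub_mulVec,
    one_mulVec, vecMulVec_mulVec, op_smul_eq_smul, smul_smul, mul_comm r]

theorem isIsometry_reflectionMatrix {M : Matrix n n R} (hM : M.IsSymm) {r : R} {u : n → R}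
    (hr : r * (u ⬝ᵥ M *ᵥ u) = 2) : IsIsometry M (reflectionMatrix M r u) := by
  have hu : u ᵥ* M = M *ᵥ u := by rw [← mulVec_transpose, hM.eq]
  have h : (M *ᵥ u) ⬝ᵥ u = u ⬝ᵥ M *ᵥ u := dotProduct_comm _ _
  unfold IsIsometry reflectionMatrix
  simp only [transpose_sub, transpose_one, transpose_vecMulVec, Matrix.sub_mul, Matrix.mul_sub,
    Matrix.one_mul, Matrix.mul_one, vecMulVec_mul, mul_vecMulVec, smul_vecMul, mulVec_smul, hu,
    sub_mulVec, vecMulVec_mulVec, op_smul_eq_smul]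
  ext i j
  simp only [Matrix.sub_apply, Pi.sub_apply, vecMulVec_apply, Pi.smul_apply, smul_eq_mul,
    smul_dotProduct, h]
  linear_combination (M *ᵥ u) i * (M *ᵥ u) j * r * hr

theorem det_reflectionMatrix {M : Matrix n n R} {r : R} {u : n → R}
    (hr : r * (u ⬝ᵥ M *ᵥ u) = 2) : (reflectionMatrix M r u).det = -1 := by
  have : reflectionMatrix M r u =
      1 + replicateCol Unit (-(r • u)) * replicateRow Unit (M *ᵥ u) := by
    rw [← vecMulVec_eq, reflectionMatrix, neg_vecMulVec, sub_eq_add_neg]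
  rw [this, det_one_add_replicateCol_mul_replicateRow, dotProduct_neg, dotProduct_smul,
    dotProduct_comm, smul_eq_mul, hr]
  norm_num

/-- Reflecting in `x - y` exchanges two vectors `x`, `y` of the same length. -/
theorem exists_isIsometry_of_isUnit_sub {M : Matrix n n R} (hM : M.IsSymm) {x y : n → R}
    (hxy : x ⬝ᵥ M *ᵥ x = y ⬝ᵥ M *ᵥ y) (hu : IsUnit ((x - y) ⬝ᵥ M *ᵥ (x - y))) :
    ∃ k, IsIsometry M k ∧ k *ᵥ x = y ∧
      ∀ z, x ⬝ᵥ M *ᵥ z = 0 → y ⬝ᵥ M *ᵥ z = 0 → k *ᵥ z = z := by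
  obtain ⟨s, hs⟩ := hu.exists_left_inv
  refine ⟨reflectionMatrix M (2 * s) (x - y), isIsometry_reflectionMatrix hM ?_, ?_, ?_⟩
  · linear_combination 2 * hs
  · have h : 2 * s * ((x - y) ⬝ᵥ M *ᵥ x) = 1 := by
      rw [← hs]
      simp only [sub_dotProduct, mulVec_sub, dotProduct_sub]
      linear_combination (-s) * dotProduct_mulVec_comm_of_isSymm hM y x + s * hxy
    rw [reflectionMatrix_mulVec hM, h]
    simp
  · intro z hx hy
    simp [reflectionMatrix_mulVec hM, sub_dotProduct, hx, hy]

theorem IsIsometry.det_eq_one_or_eq_neg_one [IsDomain R] {M k : Matrix n n R} (hdet : M.det ≠ 0)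
    (hk : IsIsometry M k) : k.det = 1 ∨ k.det = -1 := by
  have h := congrArg det hk
  rw [det_mul, det_mul, det_transpose] at h
  exact sq_eq_one_iff.1 (mul_right_cancel₀ hdet (by linear_combination h))

variable [IsLocalRing R]

/-- Over a local ring in which `2` is a unit, isometries act transitively on the vectors of a given
unit length, and the isometry may be chosen to fix everything orthogonal to both vectors. -/
theorem exists_isIsometry_mulVec_eq (h2 : IsUnit (2 : R)) {M : Matrix n n R} (hM : M.IsSymm)
    {x y : n → R} (hxy : x ⬝ᵥ M *ᵥ x = y ⬝ᵥ M *ᵥ y) (hy : IsUnit (y ⬝ᵥ M *ᵥ y)) :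
    ∃ k, IsIsometry M k ∧ k *ᵥ x = y ∧
      ∀ z, x ⬝ᵥ M *ᵥ z = 0 → y ⬝ᵥ M *ᵥ z = 0 → k *ᵥ z = z := by
  have hsum : (x - y) ⬝ᵥ M *ᵥ (x - y) + (x - -y) ⬝ᵥ M *ᵥ (x - -y) = 2 * 2 * (y ⬝ᵥ M *ᵥ y) := by
    simp only [sub_neg_eq_add, sub_dotProduct, mulVec_sub, dotProduct_sub, add_dotProduct,
      mulVec_add, dotProduct_add]
    linear_combination 2 * hxy
  have hneg : (-y) ⬝ᵥ M *ᵥ (-y) = y ⬝ᵥ M *ᵥ y := by simp [mulVec_neg]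
  rcases IsLocalRing.isUnit_or_isUnit_of_isUnit_add (hsum ▸ (h2.mul h2).mul hy) with h | h
  · exact exists_isIsometry_of_isUnit_sub hM hxy h
  · obtain ⟨k, hk, hkx, hkz⟩ := exists_isIsometry_of_isUnit_sub hM (hxy.trans hneg.symm) h
    have h' : IsUnit ((-y - y) ⬝ᵥ M *ᵥ (-y - y)) := by
      convert (h2.mul h2).mul hy using 1
      simp only [sub_dotProduct, mulVec_sub, dotProduct_sub, mulVec_neg, dotProduct_neg,
        neg_dotProduct]
      ring
    obtain ⟨l, hl, hly, hlz⟩ := exists_isIsometry_of_isUnit_sub hM hneg h'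
    refine ⟨l * k, hl.mul hk, by rw [← mulVec_mulVec, hkx, hly], fun z hx hy => ?_⟩
    have hny : (-y) ⬝ᵥ M *ᵥ z = 0 := by rw [neg_dotProduct, hy, neg_zero]
    rw [← mulVec_mulVec, hkz z hx hny, hlz z hny hy]

/-- Witt extension for pairs of orthogonal vectors of unit length. -/
theorem exists_isIsometry_mulVec_eq_pair (h2 : IsUnit (2 : R)) {M : Matrix n n R} (hM : M.IsSymm)
    {x x' y y' : n → R} (hx : x ⬝ᵥ M *ᵥ x = x' ⬝ᵥ M *ᵥ x') (hx' : IsUnit (x' ⬝ᵥ M *ᵥ x'))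
    (hy : y ⬝ᵥ M *ᵥ y = y' ⬝ᵥ M *ᵥ y') (hy' : IsUnit (y' ⬝ᵥ M *ᵥ y'))
    (hxy : y ⬝ᵥ M *ᵥ x = 0) (hxy' : y' ⬝ᵥ M *ᵥ x' = 0) :
    ∃ k, IsIsometry M k ∧ k *ᵥ x = x' ∧ k *ᵥ y = y' := by
  obtain ⟨k, hk, hkx, -⟩ := exists_isIsometry_mulVec_eq h2 hM hx hx'
  obtain ⟨l, hl, hly, hlz⟩ := exists_isIsometry_mulVec_eq h2 hM
    ((hk.dotProduct y y).trans hy) hy'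
  refine ⟨l * k, hl.mul hk, ?_, by rw [← mulVec_mulVec, hly]⟩
  rw [← mulVec_mulVec, hkx]
  exact hlz _ (by rw [← hkx, hk.dotProduct, hxy]) hxy'

/-- A unimodular sublattice of smaller rank has a vector of unit length orthogonal to it. -/
theorem exists_isUnit_dotProduct_of_card_lt [Fintype m] [DecidableEq m] (h2 : IsUnit (2 : R))
    {M : Matrix n n R} (hM : M.IsSymm) (hdet : IsUnit M.det) (X : Matrix n m R)
    (hX : IsUnit (Xᵀ * M * X).det) (hcard : Fintype.card m < Fintype.card n) :
    ∃ z, Xᵀ *ᵥ (M *ᵥ z) = 0 ∧ IsUnit (z ⬝ᵥ M *ᵥ z) := by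
  set Y : Matrix m n R := (Xᵀ * M * X)⁻¹ * (Xᵀ * M) with hY
  set P : Matrix n n R := 1 - X * Y with hP
  have hXP : Xᵀ * M * P = 0 := by
    rw [hP, Matrix.mul_sub, Matrix.mul_one, ← Matrix.mul_assoc, hY, ← Matrix.mul_assoc,
      mul_nonsing_inv _ hX, Matrix.one_mul, sub_self]
  have hPMP : Pᵀ * M * P = M * P := by
    have : Pᵀ = 1 - Yᵀ * Xᵀ := by rw [hP, transpose_sub, transpose_mul, transpose_one]
    rw [this, Matrix.sub_mul, Matrix.sub_mul, Matrix.one_mul, Matrix.mul_assoc Yᵀ,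
      Matrix.mul_assoc Yᵀ, hXP, Matrix.mul_zero, sub_zero]
  have hform (v w : n → R) : (P *ᵥ v) ⬝ᵥ M *ᵥ (P *ᵥ w) = v ⬝ᵥ (M * P) *ᵥ w := by
    rw [← hPMP, ← mulVec_mulVec, ← mulVec_mulVec, dotProduct_mulVec v Pᵀ, vecMul_transpose]
  by_contra! hcon
  have hnon (v : n → R) : (P *ᵥ v) ⬝ᵥ M *ᵥ (P *ᵥ v) ∈ IsLocalRing.maximalIdeal R := by
    refine (IsLocalRing.mem_maximalIdeal _).2 (hcon (P *ᵥ v) ?_)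
    rw [mulVec_mulVec, mulVec_mulVec, hXP, zero_mulVec]
  have hpair (v w : n → R) : v ⬝ᵥ (M * P) *ᵥ w ∈ IsLocalRing.maximalIdeal R := by
    have h : 2 * (v ⬝ᵥ (M * P) *ᵥ w) = (P *ᵥ (v + w)) ⬝ᵥ M *ᵥ (P *ᵥ (v + w)) -
        (P *ᵥ v) ⬝ᵥ M *ᵥ (P *ᵥ v) - (P *ᵥ w) ⬝ᵥ M *ᵥ (P *ᵥ w) := by
      rw [← hform]
      simp only [mulVec_add, add_dotProduct, dotProduct_add]
      linear_combination dotProduct_mulVec_comm_of_isSymm hM (P *ᵥ v) (P *ᵥ w)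
    rw [← Ideal.unit_mul_mem_iff_mem _ h2, h]
    exact sub_mem (sub_mem (hnon _) (hnon _)) (hnon _)
  have hres : (M * P).map (IsLocalRing.residue R) = 0 := by
    ext i j
    simpa [IsLocalRing.residue_eq_zero_iff] using hpair (Pi.single i 1) (Pi.single j 1)
  have hPres : P.map (IsLocalRing.residue R) = 0 := by
    have : P = M⁻¹ * (M * P) := by rw [← Matrix.mul_assoc, nonsing_inv_mul _ hdet, Matrix.one_mul]
    rw [this, Matrix.map_mul, hres, Matrix.mul_zero]
  have hone : (1 : Matrix n n (IsLocalRing.ResidueField R)) =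
      X.map (IsLocalRing.residue R) * Y.map (IsLocalRing.residue R) := by
    rw [← Matrix.map_mul, ← sub_eq_zero, ← hPres, hP, Matrix.map_sub _ (map_sub _),
      Matrix.map_one _ (map_zero _) (map_one _)]
  have hrank := rank_one (n := n) (R := IsLocalRing.ResidueField R)
  rw [hone] at hrank
  have := (rank_mul_le_left (X.map (IsLocalRing.residue R))
    (Y.map (IsLocalRing.residue R))).trans (rank_le_card_width _)
  omega

/-- A unimodular symmetric binary form over a local ring in which `2` is a unit represents a
unit. -/
theorem exists_isUnit_binary {a b c : R} (h2 : IsUnit (2 : R)) (h : IsUnit (a * c - b ^ 2)) :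
    ∃ s t : R, IsUnit (a * s ^ 2 + 2 * b * s * t + c * t ^ 2) := by
  by_contra! hcon
  have mem (s t : R) : a * s ^ 2 + 2 * b * s * t + c * t ^ 2 ∈ IsLocalRing.maximalIdeal R :=
    (IsLocalRing.mem_maximalIdeal _).2 (hcon s t)
  have ha : a ∈ IsLocalRing.maximalIdeal R := by simpa using mem 1 0
  have hc : c ∈ IsLocalRing.maximalIdeal R := by simpa using mem 0 1
  have hb : b ∈ IsLocalRing.maximalIdeal R := by
    rw [← Ideal.unit_mul_mem_iff_mem _ h2]
    convert sub_mem (sub_mem (mem 1 1) ha) hc using 1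
    ring
  refine (IsLocalRing.mem_maximalIdeal _).1 ?_ h
  exact sub_mem (Ideal.mul_mem_right _ _ ha) (Ideal.pow_mem_of_mem _ hb 2 two_pos)

/-- Over a local ring in which `2` is a unit, a unimodular symmetric binary form can be
diagonalized. -/
theorem exists_isUnit_det_transpose_mul_mul_eq_diagonal {a b c : R} (h2 : IsUnit (2 : R))
    (h : IsUnit (a * c - b ^ 2)) :
    ∃ (g : Matrix (Fin 2) (Fin 2) R) (α β : R), IsUnit g.det ∧ IsUnit α ∧ IsUnit β ∧
      gᵀ * !![a, b; b, c] * g = !![α, 0; 0, β] := by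
  obtain ⟨s, t, hst⟩ := exists_isUnit_binary h2 h
  refine ⟨!![s, -(b * s + c * t); t, a * s + b * t], _, _, ?_, hst, h.mul hst, ?_⟩
  · convert hst using 1
    rw [det_fin_two_of]
    ring
  · ext i j
    fin_cases i <;> fin_cases j <;> simp [Matrix.mul_apply, Fin.sum_univ_two] <;> ring

/-- Integral Witt extension for representations of a unimodular binary form. -/
theorem exists_isIsometry_mul_eq {a b c : R} (h2 : IsUnit (2 : R)) (h : IsUnit (a * c - b ^ 2))
    {M : Matrix n n R} (hM : M.IsSymm) {X Y : Matrix n (Fin 2) R}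
    (hX : Xᵀ * M * X = !![a, b; b, c]) (hY : Yᵀ * M * Y = !![a, b; b, c]) :
    ∃ k, IsIsometry M k ∧ k * X = Y := by
  obtain ⟨g, α, β, hg, hα, hβ, hdiag⟩ := exists_isUnit_det_transpose_mul_mul_eq_diagonal h2 h
  have key {Z : Matrix n (Fin 2) R} (hZ : Zᵀ * M * Z = !![a, b; b, c]) (i j : Fin 2) :
      (Z * g).col i ⬝ᵥ M *ᵥ (Z * g).col j = !![α, 0; 0, β] i j := by
    rw [← hdiag, ← hZ]
    have : gᵀ * (Zᵀ * M * Z) * g = (Z * g)ᵀ * (M * (Z * g)) := by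
      simp only [transpose_mul, Matrix.mul_assoc]
    rw [this, Matrix.mul_apply_eq_vecMul]
    rfl
  obtain ⟨k, hk, h0, h1⟩ := exists_isIsometry_mulVec_eq_pair h2 hM
    ((key hX 0 0).trans (key hY 0 0).symm) (by simpa [key hY 0 0] using hα)
    ((key hX 1 1).trans (key hY 1 1).symm) (by simpa [key hY 1 1] using hβ)
    (key hX 1 0) (key hY 1 0)
  refine ⟨k, hk, ?_⟩
  have hkg : k * X * g = Y * g := by
    rw [Matrix.mul_assoc]
    ext i j
    fin_cases j
    · exact congrFun h0 i
    · exact congrFun h1 i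
  rw [← Matrix.mul_one (k * X), ← mul_nonsing_inv g hg, ← Matrix.mul_assoc, hkg,
    Matrix.mul_assoc, mul_nonsing_inv g hg, Matrix.mul_one]

end Isometries

/-- integral Witt extension over `ℤ_p`.  Let `p` be an odd prime and `Q`
a positive definite integral quadratic form in 4 variables whose discriminant is a `p`-adic
unit; `MQp` is its Gram matrix viewed over `ℤ_p`.  Let `q(x,y) = a·x² + b·x·y + c·y²` be a
binary quadratic form over `ℤ_p` (with `b = 2·b2`) with `disc(q) = a·c − b²/4 ∈ ℤ_p^×`.
If `ι₁, ι₂ : ℤ_p² → ℤ_p⁴` both represent `q` by `Q`, then there is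
`k ∈ Mat₄(ℤ_p)` with `kᵀ·MQ·k = MQ`, `det k = 1` and `k ∘ ι₁ = ι₂`. -/
theorem integral_witt_extension (p : ℕ) [hp : Fact p.Prime] (hp2 : p ≠ 2)
    (MQ : Matrix (Fin 4) (Fin 4) ℚ) (hQ : IsIntegralPosDefForm MQ)
    (hdisc : padicValRat p MQ.det = 0)
    (MQp : Matrix (Fin 4) (Fin 4) ℤ_[p])
    (hcast : ∀ i j, ((MQp i j : ℚ_[p]) = ((MQ i j : ℚ) : ℚ_[p])))
    (a b b2 c : ℤ_[p]) (hb : 2 * b2 = b) (hq : IsUnit (a * c - b2 ^ 2))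
    (ι1 ι2 : Matrix (Fin 4) (Fin 2) ℤ_[p])
    (h1 : ι1ᵀ * MQp * ι1 = !![a, b2; b2, c])
    (h2 : ι2ᵀ * MQp * ι2 = !![a, b2; b2, c]) :
    ∃ k : Matrix (Fin 4) (Fin 4) ℤ_[p],
      kᵀ * MQp * k = MQp ∧ k.det = 1 ∧ k * ι1 = ι2 := by
  have hdetQ : MQ.det ≠ 0 := by
    intro h0
    obtain ⟨v, hv, hMv⟩ := exists_mulVec_eq_zero_iff.2 h0
    simpa [hMv] using hQ.2.2.2 v hv
  have hM : MQp.IsSymm := by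
    refine IsSymm.ext fun i j => Subtype.ext ?_
    rw [hcast, hcast, hQ.1.apply]
  have hmap : MQp.map (PadicInt.Coe.ringHom (p := p)) = MQ.map (Rat.castHom ℚ_[p]) :=
    Matrix.ext hcast
  have hdet : IsUnit MQp.det := by
    have hcoe : (MQp.det : ℚ_[p]) = (MQ.det : ℚ) := by
      have := congrArg det hmap
      rwa [← RingHom.mapMatrix_apply, ← RingHom.map_det, ← RingHom.mapMatrix_apply,
        ← RingHom.map_det] at this
    rw [PadicInt.isUnit_iff, PadicInt.norm_def, hcoe, Padic.eq_padicNorm,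
      padicNorm.eq_zpow_of_nonzero hdetQ, hdisc]
    simp
  have htwo : IsUnit (2 : ℤ_[p]) := by
    have : IsUnit ((2 : ℕ) : ℤ_[p]) := PadicInt.isUnit_iff.2 <| PadicInt.norm_natCast_eq_one_iff.2 <|
      (Nat.coprime_primes hp.out Nat.prime_two).2 hp2
    exact_mod_cast this
  obtain ⟨k, hk, hkι⟩ := exists_isIsometry_mul_eq htwo hq hM h1 h2
  rcases hk.det_eq_one_or_eq_neg_one hdet.ne_zero with h | h
  · exact ⟨k, hk, h, hkι⟩
  · have hunit : IsUnit (ι2ᵀ * MQp * ι2).det := by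
      rwa [h2, det_fin_two_of, ← sq]
    obtain ⟨z, hz, hzu⟩ := exists_isUnit_dotProduct_of_card_lt htwo hM hdet ι2 hunit (by simp)
    obtain ⟨s, hs⟩ := hzu.exists_left_inv
    have hr : 2 * s * (z ⬝ᵥ MQp *ᵥ z) = 2 := by linear_combination 2 * hs
    refine ⟨reflectionMatrix MQp (2 * s) z * k, (isIsometry_reflectionMatrix hM hr).mul hk, ?_, ?_⟩
    · rw [det_mul, det_reflectionMatrix hr, h]
      norm_num
    · rw [Matrix.mul_assoc, hkι, reflectionMatrix, Matrix.sub_mul, Matrix.one_mul, vecMulVec_mul,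
        ← mulVec_transpose, hz]
      ext
      simp [vecMulVec_apply]
end

section
/- Let q(x,y) = A·x² + B·x·y + C·y² be a primitive positive definite integral binary quadratic form with discriminant D = A·C − B²/4, let Q be a positive definite integral quadratic form in 4 variables, let p be an odd prime with v_p(D) = 0, and let n ∈ ℕ. Let (ι1,ι2) ∈ 𝒳(Q,2n), and set x1 = ⟨ι1(e1), ι2(e1)⟩_Q, x2 = ⟨ι1(e1), ι2(e2)⟩_Q, x3 = ⟨ι1(e2), ι2(e1)⟩_Q, x4 = ⟨ι1(e2), ι2(e2)⟩_Q, where e1,e2 is the standard basis of ℤ². Then x1·x4 − x2·x3 ≡ D (mod p^{4n}), C·x1 ≡ A·x4 (mod p^{4n}), C·(x2+x3) ≡ B·x4 (mod p^{4n}), and A·(x2+x3) ≡ B·x1 (mod p^{4n}). -/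
open Matrix

noncomputable section

/-- Congruence of rationals modulo `p^k`: `v_p(a − b) ≥ k` (with `v_p(0) = ∞`). -/
def PCong (p k : ℕ) (a b : ℚ) : Prop :=
  a = b ∨ (k : ℤ) ≤ padicValRat p (a - b)

/-- Coordinatewise cast of an integer vector to a rational vector. -/
def intCastVec {m : ℕ} (v : Fin m → ℤ) : Fin m → ℚ := fun i => (v i : ℚ)

/-- `ι : ℤ² → ℤ⁴` (a 4×2 integer matrix) is a representation of the binary quadratic form
`A·x² + B·x·y + C·y²` by the quaternary form with Gram matrix `MQ`. -/
def IsRep (MQ : Matrix (Fin 4) (Fin 4) ℚ) (A B C : ℤ) (ι : Matrix (Fin 4) (Fin 2) ℤ) : Prop :=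
  (ι.map (Int.cast : ℤ → ℚ))ᵀ * MQ * ι.map (Int.cast : ℤ → ℚ) =
    !![(A : ℚ), (B : ℚ) / 2; (B : ℚ) / 2, (C : ℚ)]

/-- A representation is primitive if `ι(ℤ²) = (ι(ℤ²) ⊗ ℚ) ∩ ℤ⁴`. -/
def IsPrimitiveRep (MQ : Matrix (Fin 4) (Fin 4) ℚ) (A B C : ℤ)
    (ι : Matrix (Fin 4) (Fin 2) ℤ) : Prop :=
  IsRep MQ A B C ι ∧
    ∀ v : Fin 4 → ℤ,
      intCastVec v ∈ Submodule.span ℚ (Set.range fun j => intCastVec fun i => ι i j) →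
        ∃ w : Fin 2 → ℤ, ι.mulVec w = v

/-- The set `𝒳(Q, m)` of pairs of primitive representations of `q = ⟨A,B,C⟩` by `Q` with
distinct images which agree modulo `p^m` up to a special orthogonal `ℤ_p`-rotation fixing
the orthogonal complement of the first image pointwise. -/
def XSet (MQ : Matrix (Fin 4) (Fin 4) ℚ) (A B C : ℤ) (p : ℕ) [Fact p.Prime] (m : ℕ) :
    Set (Matrix (Fin 4) (Fin 2) ℤ × Matrix (Fin 4) (Fin 2) ℤ) :=
  {P | IsPrimitiveRep MQ A B C P.1 ∧ IsPrimitiveRep MQ A B C P.2 ∧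
    {v : Fin 4 → ℤ | ∃ w, P.1.mulVec w = v} ≠ {v : Fin 4 → ℤ | ∃ w, P.2.mulVec w = v} ∧
    ∃ k : Matrix (Fin 4) (Fin 4) ℤ_[p],
      (k.map (fun z : ℤ_[p] => (z : ℚ_[p])))ᵀ * MQ.map (fun x : ℚ => (x : ℚ_[p])) *
          k.map (fun z : ℤ_[p] => (z : ℚ_[p])) = MQ.map (fun x : ℚ => (x : ℚ_[p])) ∧
      k.det = 1 ∧
      (∀ w : Fin 4 → ℚ_[p],
        (∀ v : Fin 2 → ℤ,
          w ⬝ᵥ (MQ.map (fun x : ℚ => (x : ℚ_[p]))).mulVec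
            (fun i => ((P.1.mulVec v) i : ℚ_[p])) = 0) →
        (k.map (fun z : ℤ_[p] => (z : ℚ_[p]))).mulVec w = w) ∧
      ∀ v : Fin 2 → ℤ, ∀ i,
        (p : ℤ_[p]) ^ m ∣
          (((P.2.mulVec v) i : ℤ_[p]) -
            k.mulVec (fun i' => ((P.1.mulVec v) i' : ℤ_[p])) i)}

/-- `⟨ι1(e_{j1}), ι2(e_{j2})⟩_Q`. -/
def pairInner (MQ : Matrix (Fin 4) (Fin 4) ℚ) (ι1 ι2 : Matrix (Fin 4) (Fin 2) ℤ)
    (j1 j2 : Fin 2) : ℚ :=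
  (intCastVec fun i => ι1 i j1) ⬝ᵥ MQ.mulVec (intCastVec fun i => ι2 i j2)

section NearbyRepresentations

variable {R m l : Type*} [CommRing R] [Fintype m] [Fintype l] [DecidableEq l]

lemma isSymm_of_inv_gram {M : Matrix m m R} {U : Matrix m l R} {G' : Matrix l l R}
    (hM : M.IsSymm) (hG : Uᵀ * M * U * G' = 1) : G'ᵀ = G' := by
  have hs : (Uᵀ * M * U)ᵀ = Uᵀ * M * U := by
    simp [Matrix.transpose_mul, hM.eq, Matrix.mul_assoc]
  have h1 : G'ᵀ * (Uᵀ * M * U) = 1 := by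
    have := congrArg Matrix.transpose hG
    rwa [Matrix.transpose_mul, hs, Matrix.transpose_one] at this
  calc G'ᵀ = G'ᵀ * (Uᵀ * M * U * G') := by rw [hG, Matrix.mul_one]
    _ = (G'ᵀ * (Uᵀ * M * U)) * G' := by simp only [Matrix.mul_assoc]
    _ = G' := by rw [h1, Matrix.one_mul]

variable [DecidableEq m]

/-- The `M`-orthogonal projection onto the complement of the columns of `U`, where `G'` is the
inverse of the Gram matrix of `U`. -/
def perpProj (M : Matrix m m R) (U : Matrix m l R) (G' : Matrix l l R) : Matrix m m R :=
  1 - U * G' * Uᵀ * M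

lemma transpose_mul_perpProj {M : Matrix m m R} {U : Matrix m l R} {G' : Matrix l l R}
    (hG : Uᵀ * M * U * G' = 1) : Uᵀ * M * perpProj M U G' = 0 := by
  have h : Uᵀ * M * (U * G' * Uᵀ * M) = (Uᵀ * M * U * G') * (Uᵀ * M) := by
    simp only [Matrix.mul_assoc]
  rw [perpProj, Matrix.mul_sub, h, hG]
  simp

lemma perpProj_mul {M : Matrix m m R} {U : Matrix m l R} {G' : Matrix l l R}
    (hG' : G' * (Uᵀ * M * U) = 1) : perpProj M U G' * U = 0 := by
  have h : U * G' * Uᵀ * M * U = U * (G' * (Uᵀ * M * U)) := by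
    simp only [Matrix.mul_assoc]
  rw [perpProj, Matrix.sub_mul, h, hG']
  simp

lemma transpose_perpProj_mul {M : Matrix m m R} {U : Matrix m l R} {G' : Matrix l l R}
    (hM : M.IsSymm) (hG : Uᵀ * M * U * G' = 1) :
    (perpProj M U G')ᵀ * M = M * perpProj M U G' := by
  have hs := isSymm_of_inv_gram hM hG
  simp [perpProj, Matrix.transpose_mul, hM.eq, hs, Matrix.sub_mul, Matrix.mul_sub,
    Matrix.mul_assoc]

/-- An isometry fixing the complement of the span of `U` preserves this span. -/
lemma perpProj_mul_isometry_mul [IsDomain R] {M k : Matrix m m R} {U : Matrix m l R}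
    {G' : Matrix l l R} (hM : M.IsSymm) (hdet : M.det ≠ 0) (hG : Uᵀ * M * U * G' = 1)
    (hk : kᵀ * M * k = M) (hfix : k * perpProj M U G' = perpProj M U G') :
    perpProj M U G' * (k * U) = 0 := by
  have hG' : G' * (Uᵀ * M * U) = 1 := mul_eq_one_comm.mp hG
  have h : M * (perpProj M U G' * (k * U)) = 0 := by
    calc M * (perpProj M U G' * (k * U)) = (perpProj M U G')ᵀ * M * (k * U) := by
          rw [transpose_perpProj_mul hM hG, Matrix.mul_assoc]
      _ = (k * perpProj M U G')ᵀ * M * (k * U) := by rw [hfix]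
      _ = (perpProj M U G')ᵀ * (kᵀ * M * k) * U := by
          simp only [Matrix.transpose_mul, Matrix.mul_assoc]
      _ = M * (perpProj M U G' * U) := by
          rw [hk, transpose_perpProj_mul hM hG, Matrix.mul_assoc]
      _ = 0 := by rw [perpProj_mul hG', Matrix.mul_zero]
  have h2 := congrArg (fun N => M.adjugate * N) h
  simp only [← Matrix.mul_assoc, Matrix.adjugate_mul, Matrix.mul_zero] at h2
  rw [Matrix.smul_mul, Matrix.one_mul, Matrix.smul_mul, Matrix.smul_mul] at h2
  rw [← Matrix.mul_assoc]
  exact (smul_eq_zero.mp h2).resolve_left hdet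

/-- The determinant of an isometry fixing the complement of the span of `U` can be computed on
this span. -/
lemma det_transpose_mul_isometry_mul [IsDomain R] {M k : Matrix m m R} {U : Matrix m l R}
    {G' : Matrix l l R} (hM : M.IsSymm) (hdet : M.det ≠ 0) (hG : Uᵀ * M * U * G' = 1)
    (hk : kᵀ * M * k = M) (hfix : k * perpProj M U G' = perpProj M U G') :
    (Uᵀ * M * (k * U)).det = (Uᵀ * M * U).det * k.det := by
  have hG' : G' * (Uᵀ * M * U) = 1 := mul_eq_one_comm.mp hG
  have h0 := perpProj_mul_isometry_mul hM hdet hG hk hfix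
  set g : Matrix l l R := G' * (Uᵀ * M * (k * U)) with hg
  have hkU : k * U = U * g := by
    rw [perpProj, Matrix.sub_mul, Matrix.one_mul, sub_eq_zero] at h0
    rw [h0.trans]
    simp only [hg, Matrix.mul_assoc]
  have hk1 : k = 1 + U * ((g - 1) * (G' * Uᵀ * M)) := by
    have h1 : k - k * U * (G' * Uᵀ * M) = 1 - U * (G' * Uᵀ * M) := by
      rw [perpProj, Matrix.mul_sub, Matrix.mul_one] at hfix
      simpa only [Matrix.mul_assoc] using hfix
    rw [hkU] at h1
    rw [Matrix.sub_mul, Matrix.one_mul, Matrix.mul_sub, ← Matrix.mul_assoc U g]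
    rw [sub_eq_iff_eq_add] at h1
    rw [h1]
    abel
  have hdetk : k.det = g.det := by
    conv_lhs => rw [hk1]
    rw [Matrix.det_one_add_mul_comm]
    congr 1
    calc 1 + (g - 1) * (G' * Uᵀ * M) * U = 1 + (g - 1) * (G' * (Uᵀ * M * U)) := by
          simp only [Matrix.mul_assoc]
      _ = g := by rw [hG', Matrix.mul_one]; abel
  rw [hkU, ← Matrix.mul_assoc, Matrix.det_mul, hdetk]

/-- The Gram matrix of `V` minus that of its projection to the span of `U`. -/
lemma gram_sub_gram_proj {M : Matrix m m R} {U V : Matrix m l R} {G' : Matrix l l R}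
    (hM : M.IsSymm) (hG : Uᵀ * M * U * G' = 1) :
    Vᵀ * M * V - (Uᵀ * M * V)ᵀ * G' * (Uᵀ * M * V) =
      (perpProj M U G' * V)ᵀ * M * (perpProj M U G' * V) := by
  have h1 : (perpProj M U G' * V)ᵀ * M * (perpProj M U G' * V) =
      Vᵀ * (M * perpProj M U G' * perpProj M U G') * V := by
    rw [Matrix.transpose_mul, Matrix.mul_assoc Vᵀ, transpose_perpProj_mul hM hG]
    simp only [Matrix.mul_assoc]
  have h2 : M * perpProj M U G' * perpProj M U G' = M * perpProj M U G' := by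
    have h3 : perpProj M U G' * perpProj M U G' = perpProj M U G' := by
      nth_rewrite 1 [perpProj]
      rw [Matrix.sub_mul, Matrix.one_mul,
        show U * G' * Uᵀ * M * perpProj M U G' = U * G' * (Uᵀ * M * perpProj M U G') by
          simp only [Matrix.mul_assoc], transpose_mul_perpProj hG, Matrix.mul_zero, sub_zero]
    rw [Matrix.mul_assoc, h3]
  rw [h1, h2, perpProj]
  simp [Matrix.transpose_mul, hM.eq, Matrix.sub_mul, Matrix.mul_sub, Matrix.mul_assoc]

/-- If `V` is congruent modulo `t` to the image of `U` under an isometry fixing the complement of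
the span of `U`, then the mixed Gram matrix of `U` and `V` determines that of `V` modulo `t ^ 2`. -/
lemma exists_gram_congr [IsDomain R] {M k : Matrix m m R} {U V E : Matrix m l R}
    {G' : Matrix l l R} {t : R} (hM : M.IsSymm) (hdet : M.det ≠ 0) (hG : Uᵀ * M * U * G' = 1)
    (hk : kᵀ * M * k = M) (hfix : k * perpProj M U G' = perpProj M U G')
    (hV : V = k * U + t • E) :
    ∃ F : Matrix l l R,
      Vᵀ * M * V - (Uᵀ * M * V)ᵀ * G' * (Uᵀ * M * V) = t ^ 2 • F := by
  refine ⟨(perpProj M U G' * E)ᵀ * M * (perpProj M U G' * E), ?_⟩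
  rw [gram_sub_gram_proj hM hG, hV, Matrix.mul_add,
    perpProj_mul_isometry_mul hM hdet hG hk hfix, zero_add, Matrix.mul_smul,
    Matrix.transpose_smul, Matrix.smul_mul, Matrix.smul_mul, Matrix.mul_smul, smul_smul, sq]

lemma dvd_det_add_smul_sub (X Y : Matrix (Fin 2) (Fin 2) R) (t : R) :
    t ∣ (X + t • Y).det - X.det := by
  refine ⟨X 0 0 * Y 1 1 + Y 0 0 * X 1 1 + t * (Y 0 0 * Y 1 1) - X 0 1 * Y 1 0 - Y 0 1 * X 1 0 -
    t * (Y 0 1 * Y 1 0), ?_⟩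
  simp only [Matrix.det_fin_two, Matrix.add_apply, Matrix.smul_apply, smul_eq_mul]
  ring

/-- The determinant of the mixed Gram matrix is as expected modulo `t ^ 2`. -/
lemma sq_dvd_det_sub_of_gram_congr {G G' X F : Matrix (Fin 2) (Fin 2) R} {t : R}
    (hG : G * G' = 1) (hF : G - Xᵀ * G' * X = t ^ 2 • F) (hu : IsUnit (X.det + G.det)) :
    t ^ 2 ∣ X.det - G.det := by
  have h1 : t ^ 2 ∣ G.det - (Xᵀ * G' * X).det := by
    have := dvd_det_add_smul_sub (Xᵀ * G' * X) F (t ^ 2)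
    rwa [← hF, add_sub_cancel] at this
  have h2 : G.det * G'.det = 1 := by rw [← Matrix.det_mul, hG, Matrix.det_one]
  have h3 : (X.det - G.det) * (X.det + G.det) = -(G.det * (G.det - (Xᵀ * G' * X).det)) := by
    rw [Matrix.det_mul, Matrix.det_mul, Matrix.det_transpose]
    linear_combination (-X.det ^ 2) * h2
  rw [← hu.dvd_mul_right, h3]
  exact (h1.mul_left _).neg_right

lemma sq_dvd_mul_adjugate_sub {G G' X F : Matrix (Fin 2) (Fin 2) R} {t : R}
    (hG : G * G' = 1) (hF : G - Xᵀ * G' * X = t ^ 2 • F) (hd : t ^ 2 ∣ X.det - G.det)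
    (i j : Fin 2) : t ^ 2 ∣ (G * X.adjugate - Xᵀ * G.adjugate) i j := by
  obtain ⟨s, hs⟩ := hd
  have hadj : G.adjugate = G.det • G' := by
    calc G.adjugate = G.adjugate * (G * G') := by rw [hG, Matrix.mul_one]
      _ = G.det • G' := by rw [← Matrix.mul_assoc, Matrix.adjugate_mul, Matrix.smul_mul,
          Matrix.one_mul]
  have hX : X.det = G.det + t ^ 2 * s := by linear_combination hs
  have h : G * X.adjugate - Xᵀ * G.adjugate = t ^ 2 • (F * X.adjugate + s • (Xᵀ * G')) := by
    have h1 := congrArg (fun N => N * X.adjugate) hF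
    simp only [Matrix.sub_mul, Matrix.smul_mul, Matrix.mul_assoc, Matrix.mul_adjugate, Matrix.mul_smul,
      Matrix.mul_one] at h1
    rw [hadj, smul_add, ← h1, hX]
    simp only [Matrix.mul_smul, add_smul, smul_smul]
    abel
  rw [h]
  exact ⟨_, rfl⟩

end NearbyRepresentations

lemma pCong_of_padicInt_dvd {p : ℕ} [Fact p.Prime] {k : ℕ} {a b : ℚ} {x : ℤ_[p]}
    (hx : (x : ℚ_[p]) = ((a - b : ℚ) : ℚ_[p])) (hd : (p : ℤ_[p]) ^ k ∣ x) : PCong p k a b := by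
  by_cases hab : a = b
  · exact Or.inl hab
  · right
    have hne : a - b ≠ 0 := sub_ne_zero.mpr hab
    have h1 : ‖x‖ ≤ (p : ℝ) ^ (-k : ℤ) := by
      rw [PadicInt.norm_le_pow_iff_mem_span_pow, Ideal.mem_span_singleton]
      exact hd
    rw [PadicInt.norm_def, hx, Padic.norm_eq_zpow_neg_valuation (mod_cast hne),
      Padic.valuation_ratCast] at h1
    have hp1 : (1 : ℝ) < p := by exact_mod_cast (Fact.out : p.Prime).one_lt
    have := (zpow_le_zpow_iff_right₀ hp1).mp h1
    omega

lemma det_ne_zero_of_isIntegralPosDefForm {n : ℕ} {M : Matrix (Fin n) (Fin n) ℚ}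
    (hM : IsIntegralPosDefForm M) : M.det ≠ 0 := by
  intro h
  obtain ⟨v, hv, hv0⟩ := Matrix.exists_mulVec_eq_zero_iff.mpr h
  have := hM.2.2.2 v hv
  simp [hv0] at this

lemma isUnit_padicInt_two {p : ℕ} [hp : Fact p.Prime] (hp2 : p ≠ 2) : IsUnit (2 : ℤ_[p]) := by
  rw [PadicInt.isUnit_iff]
  have h : ¬ ‖((2 : ℤ) : ℤ_[p])‖ < 1 := by
    rw [PadicInt.norm_int_lt_one_iff_dvd]
    intro h
    exact hp2 ((Nat.prime_dvd_prime_iff_eq hp.out Nat.prime_two).mp (by exact_mod_cast h))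
  push_cast at h
  exact le_antisymm (PadicInt.norm_le_one _) (not_lt.mp h)

/-- The Gram matrix of an integral form has entries in `ℤ_[p]` for odd `p`. -/
lemma exists_padicInt_gram {p : ℕ} [hp : Fact p.Prime] (hp2 : p ≠ 2) {n : ℕ}
    {M : Matrix (Fin n) (Fin n) ℚ} (hM : IsIntegralPosDefForm M) :
    ∃ M₀ : Matrix (Fin n) (Fin n) ℤ_[p], ∀ i j, (M₀ i j : ℚ_[p]) = (M i j : ℚ_[p]) := by
  obtain ⟨c, hc⟩ := (isUnit_padicInt_two hp2).exists_right_inv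
  choose z hz using hM.2.2.1
  refine ⟨fun i j => c * z i j, fun i j => ?_⟩
  have h1 : (2 : ℚ_[p]) * c = 1 := by exact_mod_cast congrArg (fun x : ℤ_[p] => (x : ℚ_[p])) hc
  have h2 : (2 : ℚ_[p]) * (M i j : ℚ_[p]) = (z i j : ℚ_[p]) := by
    exact_mod_cast congrArg (Rat.cast : ℚ → ℚ_[p]) (hz i j)
  push_cast
  linear_combination (M i j : ℚ_[p]) * h1 - (c : ℚ_[p]) * h2

lemma coe_gram_apply {p : ℕ} [hp : Fact p.Prime] {M : Matrix (Fin 4) (Fin 4) ℚ}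
    {M₀ : Matrix (Fin 4) (Fin 4) ℤ_[p]} (hM₀ : ∀ i j, (M₀ i j : ℚ_[p]) = (M i j : ℚ_[p]))
    (ι1 ι2 : Matrix (Fin 4) (Fin 2) ℤ) (i j : Fin 2) :
    ((((ι1.map (Int.cast : ℤ → ℤ_[p]))ᵀ * M₀ * ι2.map (Int.cast : ℤ → ℤ_[p])) i j : ℤ_[p]) :
      ℚ_[p]) = (pairInner M ι1 ι2 i j : ℚ_[p]) := by
  simp only [Matrix.mul_apply, Fin.sum_univ_four, pairInner, dotProduct, Matrix.mulVec, intCastVec,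
    Matrix.transpose_apply, Matrix.map_apply]
  push_cast
  simp only [hM₀]
  ring

lemma pairInner_self_of_isRep {M : Matrix (Fin 4) (Fin 4) ℚ} {A B C : ℤ}
    {ι : Matrix (Fin 4) (Fin 2) ℤ} (h : IsRep M A B C ι) (i j : Fin 2) :
    pairInner M ι ι i j = !![(A : ℚ), (B : ℚ) / 2; (B : ℚ) / 2, (C : ℚ)] i j := by
  have h1 := congrFun (congrFun h i) j
  rw [← h1]
  simp only [Matrix.mul_apply, Fin.sum_univ_four, pairInner, dotProduct, Matrix.mulVec, intCastVec,
    Matrix.transpose_apply, Matrix.map_apply]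
  ring

/-- Over `ℤ_[p]`, the mixed Gram matrix of a pair in `XSet` is an approximate isometry whose
determinant is close to that of the Gram matrix. -/
lemma gram_congr_of_mem_xSet {MQ : Matrix (Fin 4) (Fin 4) ℚ} (hQ : IsIntegralPosDefForm MQ)
    {A B C : ℤ} {p : ℕ} [hp : Fact p.Prime] {m : ℕ} {ι1 ι2 : Matrix (Fin 4) (Fin 2) ℤ}
    (hX : (ι1, ι2) ∈ XSet MQ A B C p m) {M₀ : Matrix (Fin 4) (Fin 4) ℤ_[p]}
    (hM₀ : ∀ i j, (M₀ i j : ℚ_[p]) = (MQ i j : ℚ_[p])) {U V : Matrix (Fin 4) (Fin 2) ℤ_[p]}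
    (hU : U = ι1.map Int.cast) (hV : V = ι2.map Int.cast) {G' : Matrix (Fin 2) (Fin 2) ℤ_[p]}
    (hG : Uᵀ * M₀ * U * G' = 1) :
    (∃ F : Matrix (Fin 2) (Fin 2) ℤ_[p],
      Vᵀ * M₀ * V - (Uᵀ * M₀ * V)ᵀ * G' * (Uᵀ * M₀ * V) = ((p : ℤ_[p]) ^ m) ^ 2 • F) ∧
    (p : ℤ_[p]) ^ m ∣ (Uᵀ * M₀ * V).det - (Uᵀ * M₀ * U).det := by
  obtain ⟨-, -, -, k, hk, hkdet, hfix, hcong⟩ := hX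
  have hinj : Function.Injective
      ((PadicInt.Coe.ringHom (p := p)).mapMatrix : Matrix (Fin 4) (Fin 4) ℤ_[p] → _) :=
    Matrix.map_injective Subtype.coe_injective
  have hMmap : MQ.map (fun x : ℚ => (x : ℚ_[p])) =
      (PadicInt.Coe.ringHom (p := p)).mapMatrix M₀ := by
    ext i j
    exact (hM₀ i j).symm
  have hM : M₀.IsSymm := by
    ext i j
    apply Subtype.coe_injective
    exact (hM₀ j i).trans ((congrArg _ (hQ.1.apply i j)).trans (hM₀ i j).symm)
  have hdet : M₀.det ≠ 0 := by
    intro h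
    apply det_ne_zero_of_isIntegralPosDefForm hQ
    have h1 : (PadicInt.Coe.ringHom (p := p)) M₀.det = (Rat.castHom ℚ_[p]) MQ.det := by
      rw [RingHom.map_det, RingHom.map_det, ← hMmap]
      rfl
    rw [h, map_zero] at h1
    exact (map_eq_zero _).mp h1.symm
  have hk0 : kᵀ * M₀ * k = M₀ := by
    apply hinj
    rw [map_mul, map_mul, ← hMmap]
    exact hk
  have hfix0 : k * perpProj M₀ U G' = perpProj M₀ U G' := by
    have hperp := transpose_mul_perpProj hG
    ext i j
    have h1 := congrFun (hfix (fun i => ((perpProj M₀ U G' i j : ℤ_[p]) : ℚ_[p])) ?_) i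
    · apply Subtype.coe_injective
      simpa [Matrix.mulVec, dotProduct, Matrix.mul_apply] using h1
    · intro v
      have h2 : ∀ a, (Uᵀ * M₀ * perpProj M₀ U G') a j = 0 := fun a => by rw [hperp]; rfl
      have h3 : (fun i => perpProj M₀ U G' i j) ⬝ᵥ
          M₀.mulVec (U.mulVec fun a => (v a : ℤ_[p])) = 0 := by
        rw [Matrix.dotProduct_mulVec, Matrix.dotProduct_mulVec, ← Matrix.mulVec_transpose M₀,
          hM.eq, ← Matrix.mulVec_transpose U, Matrix.mulVec_mulVec]
        have h4 : (Uᵀ * M₀).mulVec (fun i => perpProj M₀ U G' i j) = 0 := by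
          ext a
          exact h2 a
        rw [h4, zero_dotProduct]
      have h5 := congrArg (PadicInt.Coe.ringHom (p := p)) h3
      rw [hMmap]
      rw [map_zero] at h5
      rw [← h5]
      simp [Matrix.mulVec, dotProduct, hU]
      rfl
  have hdiv : ∀ i j, (p : ℤ_[p]) ^ m ∣ V i j - (k * U) i j := by
    intro i j
    have h1 := hcong (Pi.single j 1) i
    simp only [Matrix.mulVec_single_one] at h1
    simpa [hU, hV, Matrix.mul_apply, Matrix.mulVec, dotProduct] using h1
  choose E hE using hdiv
  have hVE : V = k * U + (p : ℤ_[p]) ^ m • Matrix.of E := by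
    ext i j
    rw [Matrix.add_apply, Matrix.smul_apply, Matrix.of_apply, smul_eq_mul, ← hE]
    ring
  refine ⟨exists_gram_congr hM hdet hG hk0 hfix0 hVE, ?_⟩
  have h1 := det_transpose_mul_isometry_mul hM hdet hG hk0 hfix0
  rw [hkdet, mul_one] at h1
  rw [← h1, hVE, Matrix.mul_add, Matrix.mul_smul]
  exact dvd_det_add_smul_sub _ _ _

/-- Let `q = ⟨A,B,C⟩` be a primitive positive definite integral binary
quadratic form of discriminant `D = A·C − B²/4`, `Q` a positive definite integral
quaternary form, `p` an odd prime with `v_p(D) = 0`, and `n ∈ ℕ`.  If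
`(ι1, ι2) ∈ 𝒳(Q, 2n)` and `x1 = ⟨ι1(e1),ι2(e1)⟩_Q`, `x2 = ⟨ι1(e1),ι2(e2)⟩_Q`,
`x3 = ⟨ι1(e2),ι2(e1)⟩_Q`, `x4 = ⟨ι1(e2),ι2(e2)⟩_Q`, then
`x1·x4 − x2·x3 ≡ D`, `C·x1 ≡ A·x4`, `C·(x2+x3) ≡ B·x4` and `A·(x2+x3) ≡ B·x1`, all
modulo `p^(4n)`. -/
theorem congruences_of_nearby_representations
    (MQ : Matrix (Fin 4) (Fin 4) ℚ) (hQ : IsIntegralPosDefForm MQ)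
    (A B C : ℤ) (hA : 0 < A) (hD : 0 < (A : ℚ) * C - (B : ℚ) ^ 2 / 4)
    (hprim : Int.gcd (Int.gcd A B) C = 1)
    (p : ℕ) [hp : Fact p.Prime] (hp2 : p ≠ 2)
    (hvD : padicValRat p ((A : ℚ) * C - (B : ℚ) ^ 2 / 4) = 0)
    (n : ℕ) (ι1 ι2 : Matrix (Fin 4) (Fin 2) ℤ)
    (hX : (ι1, ι2) ∈ XSet MQ A B C p (2 * n)) :
    PCong p (4 * n)
        (pairInner MQ ι1 ι2 0 0 * pairInner MQ ι1 ι2 1 1 -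
          pairInner MQ ι1 ι2 0 1 * pairInner MQ ι1 ι2 1 0)
        ((A : ℚ) * C - (B : ℚ) ^ 2 / 4) ∧
      PCong p (4 * n) ((C : ℚ) * pairInner MQ ι1 ι2 0 0) ((A : ℚ) * pairInner MQ ι1 ι2 1 1) ∧
      PCong p (4 * n) ((C : ℚ) * (pairInner MQ ι1 ι2 0 1 + pairInner MQ ι1 ι2 1 0))
        ((B : ℚ) * pairInner MQ ι1 ι2 1 1) ∧
      PCong p (4 * n) ((A : ℚ) * (pairInner MQ ι1 ι2 0 1 + pairInner MQ ι1 ι2 1 0))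
        ((B : ℚ) * pairInner MQ ι1 ι2 0 0) := by
  obtain ⟨M₀, hM₀⟩ := exists_padicInt_gram hp2 hQ
  set U : Matrix (Fin 4) (Fin 2) ℤ_[p] := ι1.map Int.cast with hU
  set V : Matrix (Fin 4) (Fin 2) ℤ_[p] := ι2.map Int.cast with hV
  have hGU : ∀ i j, (((Uᵀ * M₀ * U) i j : ℤ_[p]) : ℚ_[p]) =
      ((!![(A : ℚ), (B : ℚ) / 2; (B : ℚ) / 2, (C : ℚ)] i j : ℚ) : ℚ_[p]) := fun i j => by
    rw [coe_gram_apply hM₀, pairInner_self_of_isRep hX.1.1]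
  have hGV : ∀ i j, (((Vᵀ * M₀ * V) i j : ℤ_[p]) : ℚ_[p]) =
      ((!![(A : ℚ), (B : ℚ) / 2; (B : ℚ) / 2, (C : ℚ)] i j : ℚ) : ℚ_[p]) := fun i j => by
    rw [coe_gram_apply hM₀, pairInner_self_of_isRep hX.2.1.1]
  have hUV : Vᵀ * M₀ * V = Uᵀ * M₀ * U := by
    ext i j
    apply Subtype.coe_injective
    exact (hGV i j).trans (hGU i j).symm
  have hXY : ∀ i j, (((Uᵀ * M₀ * V) i j : ℤ_[p]) : ℚ_[p]) = (pairInner MQ ι1 ι2 i j : ℚ_[p]) :=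
    coe_gram_apply hM₀ ι1 ι2
  have hdetG : (((Uᵀ * M₀ * U).det : ℤ_[p]) : ℚ_[p]) =
      (((A : ℚ) * C - (B : ℚ) ^ 2 / 4 : ℚ) : ℚ_[p]) := by
    rw [Matrix.det_fin_two]
    push_cast
    simp only [hGU]
    simp
    ring
  have hunit : IsUnit (Uᵀ * M₀ * U).det := by
    rw [PadicInt.isUnit_iff, PadicInt.norm_def, hdetG,
      Padic.norm_eq_zpow_neg_valuation (mod_cast hD.ne'), Padic.valuation_ratCast, hvD]
    simp
  have hG : Uᵀ * M₀ * U * (Uᵀ * M₀ * U)⁻¹ = 1 := Matrix.mul_nonsing_inv _ hunit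
  obtain ⟨⟨F, hF⟩, hdvd⟩ := gram_congr_of_mem_xSet hQ hX hM₀ hU hV hG
  rw [hUV] at hF
  have hpow : ((p : ℤ_[p]) ^ (2 * n)) ^ 2 = (p : ℤ_[p]) ^ (4 * n) := by
    rw [← pow_mul]
    congr 1
    omega
  have hd : ((p : ℤ_[p]) ^ (2 * n)) ^ 2 ∣ (Uᵀ * M₀ * V).det - (Uᵀ * M₀ * U).det := by
    rcases Nat.eq_zero_or_pos n with rfl | hn
    · simp
    · refine sq_dvd_det_sub_of_gram_congr hG hF ?_
      have hp_dvd : (p : ℤ_[p]) ∣ (Uᵀ * M₀ * V).det - (Uᵀ * M₀ * U).det :=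
        (dvd_pow_self _ (by omega)).trans hdvd
      have h2 : IsUnit (2 * (Uᵀ * M₀ * U).det) := (isUnit_padicInt_two hp2).mul hunit
      by_contra hnu
      rw [← mem_nonunits_iff, ← IsLocalRing.mem_maximalIdeal,
        PadicInt.maximalIdeal_eq_span_p, Ideal.mem_span_singleton] at hnu
      have h3 := dvd_sub hnu hp_dvd
      rw [show (Uᵀ * M₀ * V).det + (Uᵀ * M₀ * U).det - ((Uᵀ * M₀ * V).det - (Uᵀ * M₀ * U).det) =
        2 * (Uᵀ * M₀ * U).det by ring] at h3
      exact PadicInt.prime_p.not_isUnit (isUnit_of_dvd_unit h3 h2)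
  have hadj := sq_dvd_mul_adjugate_sub hG hF hd
  rw [hpow] at hd
  simp only [hpow] at hadj
  refine ⟨pCong_of_padicInt_dvd ?_ hd, pCong_of_padicInt_dvd ?_ (hadj 0 0).neg_right,
    pCong_of_padicInt_dvd ?_ (hadj 1 0).neg_right, pCong_of_padicInt_dvd ?_ (hadj 0 1).neg_right⟩
  · rw [PadicInt.coe_sub, hdetG, Matrix.det_fin_two]
    push_cast
    simp only [hXY]
  all_goals
    rw [Matrix.sub_apply, Matrix.mul_apply, Matrix.mul_apply]
    simp only [Fin.sum_univ_two, Matrix.adjugate_fin_two, Matrix.transpose_apply, Matrix.of_apply,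
      Matrix.cons_val', Matrix.cons_val_zero, Matrix.cons_val_one, Matrix.cons_val_fin_one]
    push_cast
    simp only [hXY, hGU]
    simp
    ring
end
end

section
/- Let q(x,y) = A·x² + B·x·y + C·y² be a primitive positive definite integral binary quadratic form with discriminant D = A·C − B²/4, let p be an odd prime with v_p(D) = 0, let n ≥ 1, and let w = (w1,w2,w3,w4) with 2·w_i ∈ ℤ satisfy w1·w4 − w2·w3 ≡ D, C·w1 ≡ A·w4, C·(w2+w3) ≡ B·w4, and A·(w2+w3) ≡ B·w1, all mod p^{4n}. Define Λ_w = { (y1,y2,y3,y4) ∈ ℤ⁴ : v_p(w4·y1 + w1·y4 − w2·y3 − w3·y2) ≥ 2n, v_p(C·y1 − A·y4) ≥ 2n, v_p(C·(y2+y3) − B·y4) ≥ 2n, v_p(A·(y2+y3) − B·y1) ≥ 2n }. Then Λ_w is a subgroup of ℤ⁴ of index exactly p^{6n} (equivalently, its covolume with respect to the Euclidean norm is p^{6n}). -/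
open Matrix

noncomputable section

/-- Clearing denominators prime to `p` turns `PCong` into integer divisibility. -/
lemma pCong_iff_dvd {p : ℕ} (hp : p.Prime) {m : ℤ} (hm : ¬(p : ℤ) ∣ m) (k : ℕ) {a b : ℚ} {z : ℤ}
    (hz : m * (a - b) = z) : PCong p k a b ↔ ((p ^ k : ℕ) : ℤ) ∣ z := by
  have := Fact.mk hp
  have hm0 : (m : ℚ) ≠ 0 := by
    rintro h
    exact hm (by simp [Int.cast_eq_zero.mp h])
  push_cast
  rw [PCong, padicValInt_dvd_iff]
  have hz0 : z = 0 ↔ a = b := by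
    rw [← Int.cast_eq_zero (α := ℚ), ← hz, mul_eq_zero, or_iff_right hm0, sub_eq_zero]
  rw [hz0]
  refine or_congr_right' fun hab ↦ ?_
  have h : padicValRat p (m * (a - b)) = padicValRat p (a - b) := by
    rw [padicValRat.mul hm0 (sub_ne_zero.mpr hab), padicValRat.of_int,
      padicValInt.eq_zero_of_not_dvd hm]
    simp
  rw [← h, hz, padicValRat.of_int]
  exact Nat.cast_le

/-- Three linear congruences modulo `N` whose forms are jointly surjective cut out a subgroup of
index `N ^ 3`. -/
lemma exists_addSubgroup_index_eq (N : ℕ) (r₁ r₂ r₃ : Fin 4 → ZMod N)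
    (h : ∀ a b, ∃ y, r₁ ⬝ᵥ y = a ∧ r₂ ⬝ᵥ y = b) {k : Fin 4 → ZMod N}
    (h₁ : r₁ ⬝ᵥ k = 0) (h₂ : r₂ ⬝ᵥ k = 0) (h₃ : r₃ ⬝ᵥ k = 1) :
    ∃ H : AddSubgroup (Fin 4 → ℤ),
      (∀ y : Fin 4 → ℤ, y ∈ H ↔ r₁ ⬝ᵥ (fun i ↦ (y i : ZMod N)) = 0 ∧
        r₂ ⬝ᵥ (fun i ↦ (y i : ZMod N)) = 0 ∧ r₃ ⬝ᵥ (fun i ↦ (y i : ZMod N)) = 0) ∧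
      H.index = N ^ 3 := by
  let f : (Fin 4 → ℤ) →+ ZMod N × ZMod N × ZMod N :=
    { toFun := fun y ↦ (r₁ ⬝ᵥ (fun i ↦ (y i : ZMod N)), r₂ ⬝ᵥ (fun i ↦ (y i : ZMod N)),
        r₃ ⬝ᵥ (fun i ↦ (y i : ZMod N)))
      map_zero' := by simp [dotProduct]
      map_add' := fun x y ↦ by
        simp [dotProduct, mul_add, Finset.sum_add_distrib] }
  have hf : Function.Surjective f := by
    rintro ⟨a, b, c⟩
    obtain ⟨y, hya, hyb⟩ := h a b
    choose z hz using fun i ↦ ZMod.intCast_surjective ((y + (c - r₃ ⬝ᵥ y) • k) i)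
    refine ⟨z, ?_⟩
    have hz' : (fun i ↦ (z i : ZMod N)) = y + (c - r₃ ⬝ᵥ y) • k := funext hz
    simp [f, hz', dotProduct_add, dotProduct_smul, h₁, h₂, h₃, hya, hyb]
  refine ⟨f.ker, fun y ↦ by simp [f, AddMonoidHom.mem_ker], ?_⟩
  rw [AddSubgroup.index_ker, AddMonoidHom.range_eq_top.mpr hf, AddSubgroup.card_top]
  simp only [Nat.card_prod, Nat.card_zmod]
  ring

/-- The vectors `(A, B, 0, C)` and `(0, 1, -1, 0)` span the common kernel of the three
proportionality forms; some combination of them is sent to `1` by the form attached to `w`. -/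
lemma exists_combination_eq_one {R : Type*} [CommRing R] {A B C w₁ w₂ w₃ w₄ : R}
    (hΔ : IsUnit (4 * A * C - B ^ 2)) (h₁ : w₁ * w₄ - w₂ * w₃ = 4 * A * C - B ^ 2)
    (h₂ : C * w₁ = A * w₄) (h₃ : C * (w₂ + w₃) = B * w₄) (h₄ : A * (w₂ + w₃) = B * w₁) :
    ∃ u v, u * (w₄ * A + w₁ * C - w₃ * B) + v * (w₂ - w₃) = 1 := by
  obtain ⟨d, hd⟩ := (hΔ.pow 2).exists_left_inv
  refine ⟨d * (w₄ * A + w₁ * C - w₃ * B - B * (w₂ - w₃)), d * (A * C * (w₂ - w₃)), ?_⟩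
  rw [← hd]
  have key : (w₄ * A + w₁ * C - w₃ * B) ^ 2 - B * (w₄ * A + w₁ * C - w₃ * B) * (w₂ - w₃)
      + A * C * (w₂ - w₃) ^ 2 = (4 * A * C - B ^ 2) ^ 2 := by
    have hα : w₄ * A + w₁ * C - w₃ * B = 2 * A * w₄ - B * w₃ := by linear_combination h₂
    have hS : A * C * (w₂ + w₃) ^ 2 = B ^ 2 * (w₁ * w₄) := by
      linear_combination C * (w₂ + w₃) * h₄ + B * w₁ * h₃
    have hW : (A * w₄) ^ 2 = A * C * (w₁ * w₄) := by linear_combination -A * w₄ * h₂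
    have hP : A * B * w₄ = A * C * (w₂ + w₃) := by linear_combination -A * h₃
    rw [hα]
    linear_combination 4 * hW - 2 * (w₂ + w₃) * hP - hS + (4 * A * C - B ^ 2) * h₁
  linear_combination d * key

/-- Let `q = ⟨A,B,C⟩` be a primitive positive definite integral binary
form of discriminant `D`, `p` an odd prime with `v_p(D) = 0`, `n ≥ 1`, and let
`w = (w1,w2,w3,w4)` be half-integers satisfying the four congruences of `(S2)` mod
`p^(4n)`.  Then
`Λ_w = {y ∈ ℤ⁴ : v_p(w4·y1 + w1·y4 − w2·y3 − w3·y2) ≥ 2n, v_p(C·y1 − A·y4) ≥ 2n,`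
`v_p(C·(y2+y3) − B·y4) ≥ 2n, v_p(A·(y2+y3) − B·y1) ≥ 2n}` is a subgroup of `ℤ⁴` of
index exactly `p^(6n)`.  (Coordinates: `y1 = y 0`, `y2 = y 1`, `y3 = y 2`, `y4 = y 3`.) -/
theorem lattice_index_eq
    (A B C : ℤ) (hA : 0 < A) (hD : 0 < (A : ℚ) * C - (B : ℚ) ^ 2 / 4)
    (hprim : Int.gcd (Int.gcd A B) C = 1)
    (p : ℕ) (hp : p.Prime) (hp2 : p ≠ 2)
    (hvD : padicValRat p ((A : ℚ) * C - (B : ℚ) ^ 2 / 4) = 0)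
    (n : ℕ) (hn : 1 ≤ n)
    (w1 w2 w3 w4 : ℚ)
    (hwz : (∃ z : ℤ, 2 * w1 = z) ∧ (∃ z : ℤ, 2 * w2 = z) ∧ (∃ z : ℤ, 2 * w3 = z) ∧
      (∃ z : ℤ, 2 * w4 = z))
    (hw1 : PCong p (4 * n) (w1 * w4 - w2 * w3) ((A : ℚ) * C - (B : ℚ) ^ 2 / 4))
    (hw2 : PCong p (4 * n) ((C : ℚ) * w1) ((A : ℚ) * w4))
    (hw3 : PCong p (4 * n) ((C : ℚ) * (w2 + w3)) ((B : ℚ) * w4))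
    (hw4 : PCong p (4 * n) ((A : ℚ) * (w2 + w3)) ((B : ℚ) * w1)) :
    ∃ H : AddSubgroup (Fin 4 → ℤ),
      (H : Set (Fin 4 → ℤ)) =
          {y : Fin 4 → ℤ |
            PCong p (2 * n) (w4 * y 0 + w1 * y 3 - w2 * y 2 - w3 * y 1) 0 ∧
              PCong p (2 * n) ((C : ℚ) * y 0 - (A : ℚ) * y 3) 0 ∧
              PCong p (2 * n) ((C : ℚ) * ((y 1 : ℚ) + y 2) - (B : ℚ) * y 3) 0 ∧
              PCong p (2 * n) ((A : ℚ) * ((y 1 : ℚ) + y 2) - (B : ℚ) * y 0) 0} ∧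
        H.index = p ^ (6 * n) := by
  have hp2' : ¬(p : ℤ) ∣ 2 := by
    intro h
    exact hp2 ((Nat.prime_dvd_prime_iff_eq hp Nat.prime_two).mp (by exact_mod_cast h))
  have hpZ : Prime (p : ℤ) := Nat.prime_iff_prime_int.mp hp
  have hp4 : ¬(p : ℤ) ∣ 4 := fun h ↦ hp2' (or_self_iff.mp (hpZ.dvd_or_dvd (by simpa using h)))
  have hp1 : ¬(p : ℤ) ∣ 1 := fun h ↦ hpZ.not_isUnit (isUnit_of_dvd_one h)
  obtain ⟨⟨W1, hW1⟩, ⟨W2, hW2⟩, ⟨W3, hW3⟩, ⟨W4, hW4⟩⟩ := hwz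
  have unit_of {z : ℤ} (hz : ¬(p : ℤ) ∣ z) : IsUnit (z : ZMod (p ^ (2 * n))) := by
    rw [ZMod.coe_int_isUnit_iff_isCoprime]
    push_cast
    exact ((hpZ.coprime_iff_not_dvd).mpr hz).pow_left
  have hΔ : IsUnit (4 * (A : ZMod (p ^ (2 * n))) * C - (B : ZMod (p ^ (2 * n))) ^ 2) := by
    have : ¬(p : ℤ) ∣ 4 * A * C - B ^ 2 := by
      intro h
      have h' := (pCong_iff_dvd hp hp4 1 (a := (A : ℚ) * C - (B : ℚ) ^ 2 / 4) (b := 0)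
        (z := 4 * A * C - B ^ 2) (by push_cast; ring)).mpr (by simpa using h)
      rcases h' with h' | h'
      · exact hD.ne' h'
      · rw [sub_zero, hvD] at h'
        norm_num at h'
    simpa using unit_of this
  have cast_iff {m : ℤ} (hm : ¬(p : ℤ) ∣ m) {a b : ℚ} {z : ℤ} (hz : m * (a - b) = z) :
      PCong p (2 * n) a b ↔ (z : ZMod (p ^ (2 * n))) = 0 := by
    rw [pCong_iff_dvd hp hm _ hz, ZMod.intCast_zmod_eq_zero_iff_dvd]
  have weaken {a b : ℚ} (h : PCong p (4 * n) a b) : PCong p (2 * n) a b :=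
    h.imp_right fun h ↦ le_trans (by push_cast; linarith) h
  have e1 := (cast_iff hp4 (z := W1 * W4 - W2 * W3 - (4 * A * C - B ^ 2))
    (by push_cast; rw [← hW1, ← hW2, ← hW3, ← hW4]; ring)).mp (weaken hw1)
  have e2 := (cast_iff hp2' (z := C * W1 - A * W4)
    (by push_cast; rw [← hW1, ← hW4]; ring)).mp (weaken hw2)
  have e3 := (cast_iff hp2' (z := C * (W2 + W3) - B * W4)
    (by push_cast; rw [← hW2, ← hW3, ← hW4]; ring)).mp (weaken hw3)
  have e4 := (cast_iff hp2' (z := A * (W2 + W3) - B * W1)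
    (by push_cast; rw [← hW1, ← hW2, ← hW3]; ring)).mp (weaken hw4)
  push_cast at e1 e2 e3 e4
  obtain ⟨u, v, huv⟩ := exists_combination_eq_one hΔ (sub_eq_zero.mp e1) (sub_eq_zero.mp e2)
    (sub_eq_zero.mp e3) (sub_eq_zero.mp e4)
  have hmem (y : Fin 4 → ℤ) : (PCong p (2 * n) (w4 * y 0 + w1 * y 3 - w2 * y 2 - w3 * y 1) 0 ∧
      PCong p (2 * n) ((C : ℚ) * y 0 - (A : ℚ) * y 3) 0 ∧
      PCong p (2 * n) ((C : ℚ) * ((y 1 : ℚ) + y 2) - (B : ℚ) * y 3) 0 ∧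
      PCong p (2 * n) ((A : ℚ) * ((y 1 : ℚ) + y 2) - (B : ℚ) * y 0) 0) ↔
      ((W4 * y 0 + W1 * y 3 - W2 * y 2 - W3 * y 1 : ZMod (p ^ (2 * n))) = 0 ∧
      (C * y 0 - A * y 3 : ZMod (p ^ (2 * n))) = 0 ∧
      (C * (y 1 + y 2) - B * y 3 : ZMod (p ^ (2 * n))) = 0 ∧
      (A * (y 1 + y 2) - B * y 0 : ZMod (p ^ (2 * n))) = 0) := by
    rw [cast_iff hp2' (z := W4 * y 0 + W1 * y 3 - W2 * y 2 - W3 * y 1)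
        (by push_cast; rw [← hW1, ← hW2, ← hW3, ← hW4]; ring),
      cast_iff hp1 (z := C * y 0 - A * y 3) (by push_cast; ring),
      cast_iff hp1 (z := C * (y 1 + y 2) - B * y 3) (by push_cast; ring),
      cast_iff hp1 (z := A * (y 1 + y 2) - B * y 0) (by push_cast; ring)]
    push_cast
    rfl
  simp only [hmem]
  have index_eq : p ^ (6 * n) = (p ^ (2 * n)) ^ 3 := by
    rw [← pow_mul]
    congr 1
    ring
  rw [index_eq]
  generalize p ^ (2 * n) = N at *
  have hunit : IsUnit (A : ZMod N) ∨ IsUnit (B : ZMod N) ∨ IsUnit (C : ZMod N) := by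
    by_contra! h
    have dvd_of {z : ℤ} (hz : ¬IsUnit (z : ZMod N)) : (p : ℤ) ∣ z :=
      not_not.mp (mt unit_of hz)
    have := Int.dvd_coe_gcd (Int.dvd_coe_gcd (dvd_of h.1) (dvd_of h.2.1)) (dvd_of h.2.2)
    rw [hprim] at this
    exact hp1 (by simpa using this)
  set k : Fin 4 → ZMod N := ![u * A, u * B + v, -v, u * C] with hk
  have hw : ![(W4 : ZMod N), -W3, -W2, W1] ⬝ᵥ k = 1 := by
    rw [← huv]
    simp [hk, dotProduct, Fin.sum_univ_four]
    ring
  have hAC : ![(C : ZMod N), 0, 0, -A] ⬝ᵥ k = 0 := by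
    simp [hk, dotProduct, Fin.sum_univ_four]
    ring
  have hBC : ![0, (C : ZMod N), C, -B] ⬝ᵥ k = 0 := by
    simp [hk, dotProduct, Fin.sum_univ_four]
    ring
  have hAB : ![-(B : ZMod N), A, A, 0] ⬝ᵥ k = 0 := by
    simp [hk, dotProduct, Fin.sum_univ_four]
    ring
  rcases hunit with h | h | h <;> obtain ⟨i, hi⟩ := h.exists_right_inv
  · obtain ⟨H, hH, hidx⟩ := exists_addSubgroup_index_eq N _ _ _ (fun a b ↦
      ⟨![0, i * b, 0, -(i * a)], by
        simp [dotProduct, Fin.sum_univ_four, ← mul_assoc, hi]⟩) hAC hAB hw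
    refine ⟨H, Set.ext fun y ↦ ?_, hidx⟩
    simp only [SetLike.mem_coe, hH, Set.mem_ofPred_eq, dotProduct, Fin.sum_univ_four, cons_val]
    constructor
    · rintro ⟨h1, h2, h3⟩
      exact ⟨by linear_combination h3, by linear_combination h1,
        by linear_combination i * C * h2 + i * B * h1 -
          (C * (y 1 + y 2) - B * y 3 : ZMod N) * hi, by linear_combination h2⟩
    · rintro ⟨h1, h2, h3, h4⟩
      exact ⟨by linear_combination h2, by linear_combination h4, by linear_combination h1⟩
  · obtain ⟨H, hH, hidx⟩ := exists_addSubgroup_index_eq N _ _ _ (fun a b ↦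
      ⟨![-(i * b), 0, 0, -(i * a)], by
        simp [dotProduct, Fin.sum_univ_four, ← mul_assoc, hi]⟩) hBC hAB hw
    refine ⟨H, Set.ext fun y ↦ ?_, hidx⟩
    simp only [SetLike.mem_coe, hH, Set.mem_ofPred_eq, dotProduct, Fin.sum_univ_four, cons_val]
    constructor
    · rintro ⟨h1, h2, h3⟩
      exact ⟨by linear_combination h3, by linear_combination i * A * h1 - i * C * h2 -
          (C * y 0 - A * y 3 : ZMod N) * hi, by linear_combination h1,
        by linear_combination h2⟩
    · rintro ⟨h1, h2, h3, h4⟩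
      exact ⟨by linear_combination h3, by linear_combination h4, by linear_combination h1⟩
  · obtain ⟨H, hH, hidx⟩ := exists_addSubgroup_index_eq N _ _ _ (fun a b ↦
      ⟨![i * a, i * b, 0, 0], by
        simp [dotProduct, Fin.sum_univ_four, ← mul_assoc, hi]⟩) hAC hBC hw
    refine ⟨H, Set.ext fun y ↦ ?_, hidx⟩
    simp only [SetLike.mem_coe, hH, Set.mem_ofPred_eq, dotProduct, Fin.sum_univ_four, cons_val]
    constructor
    · rintro ⟨h1, h2, h3⟩
      exact ⟨by linear_combination h3, by linear_combination h1, by linear_combination h2,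
        by linear_combination i * A * h2 - i * B * h1 -
          (A * (y 1 + y 2) - B * y 0 : ZMod N) * hi⟩
    · rintro ⟨h1, h2, h3, h4⟩
      exact ⟨by linear_combination h2, by linear_combination h3, by linear_combination h1⟩
end
end

section
/- Let q(x,y) = A·x² + B·x·y + C·y² be a primitive, Minkowski reduced (|B| ≤ A ≤ C), positive definite integral binary quadratic form with discriminant D = A·C − B²/4, let Q be a positive definite integral quadratic form in 4 variables, and let p be an odd prime with v_p(D) = 0. For every ε > 0 there is a constant κ, depending only on Q, p and ε, such that for every n ∈ ℕ with p^{4n} ≤ √D and p^{4n} > 2A, one has #𝒮(n) ≤ κ·( A·D^{3/2+ε}·p^{−12n} + C·p^{−4n} ). -/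
open Matrix

noncomputable section

/-- Membership conditions for the set `𝒮(n)`. -/
def SMem (MQ : Matrix (Fin 4) (Fin 4) ℚ) (A B C : ℤ) (p n : ℕ)
    (x0 x1 x2 x3 x4 : ℚ) : Prop :=
  -- half-integrality
  (∃ z : ℤ, 2 * x0 = z) ∧ (∃ z : ℤ, 2 * x1 = z) ∧ (∃ z : ℤ, 2 * x2 = z) ∧
    (∃ z : ℤ, 2 * x3 = z) ∧ (∃ z : ℤ, 2 * x4 = z) ∧
  -- (E) the degree four equation
  MQ.det * x0 ^ 2 =
    (x1 * x4 - x2 * x3 - ((A : ℚ) * C - (B : ℚ) ^ 2 / 4)) ^ 2 -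
      ((C : ℚ) * x1 - (A : ℚ) * x4) ^ 2 -
      ((B : ℚ) * x1 - (A : ℚ) * (x2 + x3)) * ((B : ℚ) * x4 - (C : ℚ) * (x2 + x3)) ∧
  -- (S1) archimedean constraints
  |x1| ≤ (A : ℚ) ∧ |x4| ≤ (C : ℚ) ∧ x2 ^ 2 ≤ (A : ℚ) * C ∧ x3 ^ 2 ≤ (A : ℚ) * C ∧
  -- (S2) congruence constraints mod `p^(4n)`
  PCong p (4 * n) (x1 * x4 - x2 * x3) ((A : ℚ) * C - (B : ℚ) ^ 2 / 4) ∧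
  PCong p (4 * n) ((C : ℚ) * x1) ((A : ℚ) * x4) ∧
  PCong p (4 * n) ((C : ℚ) * (x2 + x3)) ((B : ℚ) * x4) ∧
  PCong p (4 * n) ((A : ℚ) * (x2 + x3)) ((B : ℚ) * x1) ∧
  -- (S3) boundary conditions
  ((x1 = (A : ℚ) ∨ x4 = (C : ℚ)) → x0 = 0 ∧ x2 = (B : ℚ) / 2 ∧ x3 = (B : ℚ) / 2) ∧
  ((x1 = -(A : ℚ) ∨ x4 = -(C : ℚ)) → x0 = 0 ∧ x2 = -((B : ℚ) / 2) ∧ x3 = -((B : ℚ) / 2))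

/-- The set `𝒮(n)` of half-integral tuples `(x0, x1, x2, x3, x4)`. -/
def SSetQ (MQ : Matrix (Fin 4) (Fin 4) ℚ) (A B C : ℤ) (p n : ℕ) : Set (Fin 5 → ℚ) :=
  {x | SMem MQ A B C p n (x 0) (x 1) (x 2) (x 3) (x 4)}

/-- The divisor bound `d(n) ≪_ε n^ε`. -/
theorem exists_card_divisors_le_rpow {ε : ℝ} (hε : 0 < ε) :
    ∃ c : ℝ, 1 ≤ c ∧ ∀ n : ℕ, n ≠ 0 → (n.divisors.card : ℝ) ≤ c * (n : ℝ) ^ ε := by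
  have hl : 0 < Real.log 2 := Real.log_pos one_lt_two
  set K : ℝ := max 1 (1 / (ε * Real.log 2))
  have hK1 : 1 ≤ K := le_max_left _ _
  have hK2 : 1 ≤ K * (ε * Real.log 2) := by
    have h : 1 / (ε * Real.log 2) ≤ K := le_max_right _ _
    rwa [div_le_iff₀ (by positivity)] at h
  set b : ℕ := ⌈(2 : ℝ) ^ (1 / ε)⌉₊
  have small (p a : ℕ) (hp : 2 ≤ p) : ((a + 1 : ℕ) : ℝ) ≤ K * ((p : ℝ) ^ a) ^ ε := by
    have h1 : ((2 : ℝ) ^ a) ^ ε ≤ ((p : ℝ) ^ a) ^ ε := by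
      gcongr
      exact_mod_cast hp
    have h2 : (a : ℝ) * (ε * Real.log 2) + 1 ≤ ((2 : ℝ) ^ a) ^ ε := by
      rw [Real.rpow_def_of_pos (by positivity), Real.log_pow]
      refine (Real.add_one_le_exp _).trans_eq' ?_
      ring
    have h3 : ((a + 1 : ℕ) : ℝ) ≤ K * ((a : ℝ) * (ε * Real.log 2) + 1) := by
      push_cast
      nlinarith [mul_le_mul_of_nonneg_left hK2 (Nat.cast_nonneg (α := ℝ) a)]
    exact h3.trans (by gcongr; exact h2.trans h1)
  have large (p a : ℕ) (hp : b ≤ p) : ((a + 1 : ℕ) : ℝ) ≤ ((p : ℝ) ^ a) ^ ε := by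
    have h0 : (2 : ℝ) ^ (1 / ε) ≤ p := (Nat.le_ceil _).trans (by exact_mod_cast hp)
    have h1 : (2 : ℝ) ≤ (p : ℝ) ^ ε := by
      calc (2 : ℝ) = ((2 : ℝ) ^ (1 / ε)) ^ ε := by
            rw [← Real.rpow_mul (by norm_num), one_div_mul_cancel hε.ne', Real.rpow_one]
        _ ≤ _ := by gcongr
    rw [← Real.rpow_natCast, ← Real.rpow_mul (by positivity), mul_comm,
      Real.rpow_mul (by positivity),
      Real.rpow_natCast]
    calc ((a + 1 : ℕ) : ℝ) ≤ (2 : ℝ) ^ a := by exact_mod_cast Nat.lt_two_pow_self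
      _ ≤ _ := by gcongr
  refine ⟨K ^ b, one_le_pow₀ hK1, fun n hn => ?_⟩
  have hfac : (n : ℝ) ^ ε = ∏ p ∈ n.primeFactors, ((p : ℝ) ^ n.factorization p) ^ ε := by
    rw [Real.finsetProd_rpow _ _ (fun _ _ => by positivity)]
    congr 1
    conv_lhs => rw [← Nat.prod_factorization_pow_eq_self hn]
    simp [Finsupp.prod]
  rw [Nat.card_divisors hn, hfac, Nat.cast_prod]
  calc ∏ p ∈ n.primeFactors, ((n.factorization p + 1 : ℕ) : ℝ)
      ≤ ∏ p ∈ n.primeFactors, ((if p < b then K else 1) *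
          ((p : ℝ) ^ n.factorization p) ^ ε) := by
        refine Finset.prod_le_prod (fun _ _ => by positivity) fun p hp => ?_
        split_ifs with h
        · exact small p _ (Nat.prime_of_mem_primeFactors hp).two_le
        · rw [one_mul]
          exact large p _ (not_lt.mp h)
    _ = (∏ p ∈ n.primeFactors, (if p < b then K else 1)) *
          ∏ p ∈ n.primeFactors, ((p : ℝ) ^ n.factorization p) ^ ε := Finset.prod_mul_distrib
    _ ≤ K ^ b * ∏ p ∈ n.primeFactors, ((p : ℝ) ^ n.factorization p) ^ ε := by
        gcongr
        rw [← Finset.prod_filter, Finset.prod_const]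
        refine pow_le_pow_right₀ hK1 ?_
        refine (Finset.card_le_card (t := Finset.range b) fun p hp => ?_).trans_eq
          (Finset.card_range b)
        simpa using (Finset.mem_filter.mp hp).2

theorem Int.dvd_two_of_sq_dvd_four_mul {k h : ℤ} (hk : Squarefree k) (hh : h ^ 2 ∣ 4 * k) :
    h ∣ 2 := by
  rcases Int.even_or_odd' h with ⟨m, rfl | rfl⟩
  · have h1 : m * m ∣ k := by
      have : 4 * (m * m) ∣ 4 * k := by convert hh using 1; ring
      exact Int.dvd_of_mul_dvd_mul_left (by norm_num) this
    exact mul_dvd_of_dvd_div ⟨1, rfl⟩ (by simpa using (hk m h1).dvd)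
  · have hc : IsCoprime ((2 * m + 1) ^ 2) (4 : ℤ) := by
      have : IsCoprime (2 * m + 1) (2 : ℤ) := ⟨1, -m, by ring⟩
      have := this.pow (m := 2) (n := 2)
      norm_num at this ⊢
      exact this
    have h1 := hc.dvd_of_dvd_mul_left hh
    rw [sq] at h1
    exact (hk _ h1).dvd

/-- For squarefree `k`, the congruence `l² ≡ -k (mod n)` has at most `2 d(n)` solutions. -/
theorem card_sqrt_neg_le {k : ℤ} (hk : Squarefree k) {n : ℕ} (hn : n ≠ 0) :
    ((Finset.Ico (0 : ℤ) n).filter fun l => (n : ℤ) ∣ l ^ 2 + k).card ≤ 2 * n.divisors.card := by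
  set R := (Finset.Ico (0 : ℤ) n).filter fun l => (n : ℤ) ∣ l ^ 2 + k with hR
  rcases R.eq_empty_or_nonempty with h | ⟨l₀, hl₀⟩
  · simp [h]
  have hmem {l : ℤ} : l ∈ R ↔ (0 ≤ l ∧ l < n) ∧ (n : ℤ) ∣ l ^ 2 + k := by simp [hR]
  rw [mul_comm, show 2 = (Finset.univ : Finset Bool).card from rfl, ← Finset.card_product]
  refine Finset.card_le_card_of_injOn (fun l => (Int.gcd (l - l₀) n, decide (2 * l < n))) ?_ ?_
  · intro l hl
    simp only [Finset.coe_product, Set.mem_prod, Finset.mem_coe, Nat.mem_divisors,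
      Finset.mem_univ, and_true]
    exact ⟨by exact_mod_cast Int.gcd_dvd_right (l - l₀) n, hn⟩
  have hl₀' := (hmem.mp hl₀).2
  intro l hl l' hl' he
  obtain ⟨⟨h0, h1⟩, h2⟩ := hmem.mp hl
  obtain ⟨⟨h0', h1'⟩, h2'⟩ := hmem.mp hl'
  simp only [Prod.mk.injEq, decide_eq_decide] at he
  obtain ⟨hg, hb⟩ := he
  set d : ℕ := Int.gcd (l - l₀) n with hd
  have hd0 : (d : ℤ) ≠ 0 := by
    simp only [hd, Ne, Int.natCast_eq_zero, Int.gcd_eq_zero_iff]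
    omega
  obtain ⟨m, hm⟩ : (d : ℤ) ∣ n := Int.gcd_dvd_right _ _
  have key {x : ℤ} (hx : (n : ℤ) ∣ x ^ 2 + k) (hxd : Int.gcd (x - l₀) n = d) : m ∣ x + l₀ := by
    obtain ⟨a, b, hab⟩ : ∃ a b : ℤ, (d : ℤ) = (x - l₀) * a + n * b :=
      ⟨_, _, by rw [← hxd]; exact Int.gcd_eq_gcd_ab _ _⟩
    have h3 : (n : ℤ) ∣ d * (x + l₀) := by
      rw [hab]
      have : ((x - l₀) * a + n * b) * (x + l₀) =
        ((x ^ 2 + k) - (l₀ ^ 2 + k)) * a + n * (b * (x + l₀)) := by ring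
      rw [this]
      exact dvd_add (Dvd.dvd.mul_right (dvd_sub hx hl₀') _) (dvd_mul_right _ _)
    rw [hm] at h3
    exact Int.dvd_of_mul_dvd_mul_left hd0 h3
  have hdl : (d : ℤ) ∣ l - l₀ := Int.gcd_dvd_left _ _
  have hdl' : (d : ℤ) ∣ l' - l₀ := by rw [hg]; exact Int.gcd_dvd_left _ _
  have hml := key h2 hd.symm
  have hml' := key h2' hg.symm
  have hdd : (d : ℤ) ∣ l - l' := by simpa using dvd_sub hdl hdl'
  have hmm : m ∣ l - l' := by simpa using dvd_sub hml hml'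
  set h : ℤ := (Int.gcd d m : ℤ) with hh
  have hhd : h ∣ d := Int.gcd_dvd_left _ _
  have hhm : h ∣ m := Int.gcd_dvd_right _ _
  have hh2 : h ∣ 2 := by
    refine Int.dvd_two_of_sq_dvd_four_mul hk ?_
    have h4 : h ∣ 2 * l₀ := by
      have := dvd_sub (hhm.trans hml) (hhd.trans hdl)
      ring_nf at this ⊢
      exact this
    have h5 : h ^ 2 ∣ l₀ ^ 2 + k := by
      rw [sq]
      exact (hm ▸ mul_dvd_mul hhd hhm : h * h ∣ (n : ℤ)).trans hl₀'
    have h6 := dvd_sub (h5.mul_left 4) (pow_dvd_pow_of_dvd h4 2)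
    ring_nf at h6 ⊢
    exact h6
  have hn2 : (n : ℤ) ∣ 2 * (l - l') := by
    refine dvd_trans ?_ (mul_dvd_mul_right hh2 _)
    rw [hh, Int.gcd_eq_gcd_ab, hm, add_mul]
    refine dvd_add ?_ ?_
    · rw [mul_assoc]
      exact mul_dvd_mul_left _ (hmm.mul_left _)
    · rw [mul_comm (d : ℤ) m, mul_assoc]
      exact mul_dvd_mul_left _ (hdd.mul_left _)
  obtain ⟨c, hc⟩ := hn2
  have hc1 : c < 2 := by nlinarith
  have hc2 : -2 < c := by nlinarith
  obtain rfl | rfl | rfl : c = -1 ∨ c = 0 ∨ c = 1 := by omega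
  all_goals omega

theorem card_coprime_rep_le {k : ℤ} (hk0 : 0 < k) (hk : Squarefree k) {n : ℕ} (hn : n ≠ 0)
    (F : Finset (ℤ × ℤ)) (hF : ∀ v ∈ F, v.1 ^ 2 + k * v.2 ^ 2 = n ∧ IsCoprime v.1 v.2) :
    F.card ≤ 18 * n.divisors.card := by
  have hn0 : (0 : ℤ) < n := by exact_mod_cast Nat.pos_of_ne_zero hn
  have ex (v : ℤ × ℤ) : ∃ l : ℤ, v ∈ F → l ∈ Finset.Ico (0 : ℤ) n ∧ (n : ℤ) ∣ v.1 - l * v.2 := by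
    by_cases hv : v ∈ F
    · obtain ⟨h1, h2⟩ := hF v hv
      have h3 : IsCoprime v.2 (n : ℤ) := by
        rw [← h1]
        have : IsCoprime v.2 (v.1 ^ 2 + v.2 * (k * v.2)) :=
          IsCoprime.add_mul_left_right (h2.symm.pow_right) _
        convert this using 1
        ring
      obtain ⟨a, b, hab⟩ := h3
      refine ⟨(v.1 * a) % n, fun _ => ⟨?_, ?_⟩⟩
      · simp [Int.emod_nonneg _ hn0.ne', Int.emod_lt_of_pos _ hn0]
      · refine ⟨v.1 * b + (v.1 * a) / n * v.2, ?_⟩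
        have := Int.emod_def (v.1 * a) n
        rw [this]
        linear_combination (-v.1) * hab
    · exact ⟨0, fun h => absurd h hv⟩
  choose L hL using ex
  set R := (Finset.Ico (0 : ℤ) n).filter fun l => (n : ℤ) ∣ l ^ 2 + k with hR
  have hcard : ((Finset.univ : Finset (SignType × SignType)) ×ˢ R).card ≤
      18 * n.divisors.card := by
    rw [Finset.card_product, show (Finset.univ : Finset (SignType × SignType)).card = 9 from rfl]
    have : R.card ≤ _ := card_sqrt_neg_le hk hn
    omega
  refine le_trans (Finset.card_le_card_of_injOn
    (fun v => ((SignType.sign v.1, SignType.sign v.2), L v)) ?_ ?_) hcard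
  · intro v hv
    have hv' := Finset.mem_coe.mp hv
    obtain ⟨h1, h2⟩ := hF v hv'
    obtain ⟨h3, h4⟩ := hL v hv'
    simp only [Finset.coe_product, Set.mem_prod, Finset.mem_coe, Finset.mem_univ, true_and,
      hR, Finset.mem_filter]
    refine ⟨h3, ?_⟩
    have hc : IsCoprime (n : ℤ) (v.2 ^ 2) := by
      rw [← h1]
      have : IsCoprime (v.1 ^ 2 + v.2 ^ 2 * k) (v.2 ^ 2) :=
          IsCoprime.add_mul_left_left (h2.pow) _
      convert this using 1
      ring
    refine hc.dvd_of_dvd_mul_left (?_ : (n : ℤ) ∣ v.2 ^ 2 * (L v ^ 2 + k))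
    have : v.2 ^ 2 * (L v ^ 2 + k) = n - (v.1 - L v * v.2) * (v.1 + L v * v.2) := by
      rw [← h1]; ring
    rw [this]
    exact dvd_sub dvd_rfl (h4.mul_right _)
  · intro v hv w hw he
    obtain ⟨h1, h2⟩ := hF v hv
    obtain ⟨-, h4⟩ := hL v hv
    obtain ⟨h1', h2'⟩ := hF w hw
    obtain ⟨-, h4'⟩ := hL w hw
    simp only [Prod.mk.injEq] at he
    obtain ⟨⟨hs1, hs2⟩, hl⟩ := he
    rw [← hl] at h4'
    obtain ⟨x, y⟩ := v
    obtain ⟨x', y'⟩ := w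
    simp only at *
    have hsgn {a b : ℤ} (h : SignType.sign a = SignType.sign b) :
        0 ≤ a * b ∧ (a * b = 0 → a = 0 ∧ b = 0) := by
      rcases lt_trichotomy a 0 with ha | ha | ha
      · rw [sign_neg ha, eq_comm, sign_eq_neg_one_iff] at h
        have := mul_pos_of_neg_of_neg ha h
        exact ⟨this.le, fun h => absurd h this.ne'⟩
      · subst ha
        rw [sign_zero, eq_comm, sign_eq_zero_iff] at h
        simp [h]
      · rw [sign_pos ha, eq_comm, sign_eq_one_iff] at h
        have := mul_pos ha h
        exact ⟨this.le, fun h => absurd h this.ne'⟩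
    obtain ⟨hx1, hx2⟩ := hsgn hs1
    obtain ⟨hy1, hy2⟩ := hsgn hs2
    have hW : 0 < x * x' + k * (y * y') := by
      rcases hx1.lt_or_eq with h | h
      · have := mul_nonneg hk0.le hy1
        linarith
      · rcases hy1.lt_or_eq with h' | h'
        · have := mul_pos hk0 h'
          linarith
        · obtain ⟨rfl, -⟩ := hx2 h.symm
          obtain ⟨rfl, -⟩ := hy2 h'.symm
          simp at h1
          omega
    have hid : (x * x' + k * (y * y')) ^ 2 + k * (x * y' - x' * y) ^ 2 = (n : ℤ) ^ 2 := by
      have : (n : ℤ) ^ 2 = (x ^ 2 + k * y ^ 2) * (x' ^ 2 + k * y' ^ 2) := by rw [h1, h1']; ring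
      rw [this]; ring
    have hdvd : (n : ℤ) ∣ x * y' - x' * y := by
      have : x * y' - x' * y = (x - L (x, y) * y) * y' - (x' - L (x, y) * y') * y := by ring
      rw [this]
      exact dvd_sub (h4.mul_right _) (h4'.mul_right _)
    have hz : x * y' - x' * y = 0 := by
      refine Int.eq_zero_of_abs_lt_dvd hdvd ?_
      refine abs_lt_of_sq_lt_sq ?_ hn0.le
      nlinarith [sq_nonneg (x * y' - x' * y), mul_pos hW hW]
    have hxx : x ∣ x' := h2.dvd_of_dvd_mul_right ⟨y', by linarith⟩
    have hxx' : x' ∣ x := h2'.dvd_of_dvd_mul_right ⟨y, by linarith⟩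
    have hyy : y ∣ y' := h2.symm.dvd_of_dvd_mul_right ⟨x', by linarith⟩
    have hyy' : y' ∣ y := h2'.symm.dvd_of_dvd_mul_right ⟨x, by linarith⟩
    have fin {a b : ℤ} (h : a ∣ b) (h' : b ∣ a) (hp : 0 ≤ a * b) : a = b := by
      rcases Int.natAbs_eq_natAbs_iff.mp (Int.natAbs_dvd_natAbs.mpr h |>.antisymm
        (Int.natAbs_dvd_natAbs.mpr h')) with e | e
      · exact e
      · subst e
        have : b = 0 := by nlinarith
        simp [this]
    rw [fin hxx hxx' hx1, fin hyy hyy' hy1]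

theorem card_rep_le_of_squarefree {k : ℤ} (hk0 : 0 < k) (hk : Squarefree k) {n : ℕ} (hn : n ≠ 0)
    (F : Finset (ℤ × ℤ)) (hF : ∀ v ∈ F, v.1 ^ 2 + k * v.2 ^ 2 = n) :
    F.card ≤ 18 * n.divisors.card ^ 2 := by
  have hg {v : ℤ × ℤ} (hv : v ∈ F) : Int.gcd v.1 v.2 ^ 2 ∣ n := by
    have h1 : (Int.gcd v.1 v.2 : ℤ) ^ 2 ∣ n := by
      rw [← hF v hv]
      exact dvd_add (pow_dvd_pow_of_dvd (Int.gcd_dvd_left _ _) 2)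
        ((pow_dvd_pow_of_dvd (Int.gcd_dvd_right _ _) 2).mul_left _)
    exact_mod_cast h1
  rw [sq, ← mul_assoc]
  refine Finset.card_le_mul_card_image_of_maps_to (f := fun v : ℤ × ℤ => Int.gcd v.1 v.2)
    (fun v hv => Nat.mem_divisors.mpr ⟨(dvd_pow_self _ two_ne_zero).trans (hg hv), hn⟩) _ ?_
  intro g _
  rcases (F.filter fun v => Int.gcd v.1 v.2 = g).eq_empty_or_nonempty with h | ⟨v₀, hv₀⟩
  · simp [h]
  rw [Finset.mem_filter] at hv₀
  obtain ⟨m, hm⟩ := hv₀.2 ▸ hg hv₀.1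
  have hg0 : g ≠ 0 := by rintro rfl; simp at hm; exact hn hm
  have hm0 : m ≠ 0 := by rintro rfl; simp at hm; exact hn hm
  have hgz : (g : ℤ) ≠ 0 := by exact_mod_cast hg0
  have hinj : Set.InjOn (fun v : ℤ × ℤ => (v.1 / (g : ℤ), v.2 / (g : ℤ)))
      (F.filter fun v => Int.gcd v.1 v.2 = g : Finset (ℤ × ℤ)) := by
    intro v hv w hw he
    have hv' := (Finset.mem_filter.mp (Finset.mem_coe.mp hv)).2
    have hw' := (Finset.mem_filter.mp (Finset.mem_coe.mp hw)).2
    simp only [Prod.mk.injEq] at he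
    have a1 : (g : ℤ) ∣ v.1 := hv' ▸ Int.gcd_dvd_left _ _
    have a2 : (g : ℤ) ∣ v.2 := hv' ▸ Int.gcd_dvd_right _ _
    have a3 : (g : ℤ) ∣ w.1 := hw' ▸ Int.gcd_dvd_left _ _
    have a4 : (g : ℤ) ∣ w.2 := hw' ▸ Int.gcd_dvd_right _ _
    exact Prod.ext ((Int.ediv_left_inj a1 a3).mp he.1) ((Int.ediv_left_inj a2 a4).mp he.2)
  rw [← Finset.card_image_of_injOn hinj]
  refine (card_coprime_rep_le hk0 hk hm0 _ ?_).trans ?_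
  · intro u hu
    obtain ⟨v, hv, rfl⟩ := Finset.mem_image.mp hu
    obtain ⟨hvF, hvg⟩ := Finset.mem_filter.mp hv
    obtain ⟨a, ha⟩ : (g : ℤ) ∣ v.1 := hvg ▸ Int.gcd_dvd_left _ _
    obtain ⟨b, hb⟩ : (g : ℤ) ∣ v.2 := hvg ▸ Int.gcd_dvd_right _ _
    have h1 := hF v hvF
    rw [ha, hb, hm] at h1
    simp only [ha, hb, Int.mul_ediv_cancel_left _ hgz]
    constructor
    · have : (g : ℤ) ^ 2 * (a ^ 2 + k * b ^ 2) = (g : ℤ) ^ 2 * m := by push_cast at h1; linarith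
      exact mul_left_cancel₀ (pow_ne_zero 2 hgz) this
    · rw [Int.isCoprime_iff_gcd_eq_one]
      rw [ha, hb, Int.gcd_mul_left] at hvg
      simpa [hg0] using hvg
  · gcongr
    exact Dvd.intro_left _ hm.symm

/-- The number of representations of `N > 0` by `X² + kY²` is `≪_ε N^ε`, uniformly in `k > 0`. -/
theorem exists_card_rep_le_rpow {ε : ℝ} (hε : 0 < ε) :
    ∃ c : ℝ, 0 < c ∧ ∀ (k N : ℤ), 0 < k → 0 < N → ∀ F : Finset (ℤ × ℤ),
      (∀ v ∈ F, v.1 ^ 2 + k * v.2 ^ 2 = N) → (F.card : ℝ) ≤ c * (N : ℝ) ^ ε := by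
  obtain ⟨c, hc1, hc⟩ := exists_card_divisors_le_rpow (half_pos hε)
  refine ⟨18 * c ^ 2, by positivity, fun k N hk hN F hF => ?_⟩
  lift k to ℕ using hk.le
  lift N to ℕ using hN.le
  obtain ⟨a, b, hab, ha⟩ := Nat.sq_mul_squarefree k
  have hb0 : (b : ℤ) ≠ 0 := by rintro h; rw [← hab] at hk; simp_all
  have ha0 : (0 : ℤ) < a := by exact_mod_cast Nat.pos_of_ne_zero ha.ne_zero
  have hN0 : N ≠ 0 := by rintro rfl; simp at hN
  have hinj : Function.Injective fun v : ℤ × ℤ => (v.1, (b : ℤ) * v.2) := by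
    intro v w he
    simp only [Prod.mk.injEq, mul_eq_mul_left_iff, hb0, or_false] at he
    exact Prod.ext he.1 he.2
  have h1 : F.card ≤ 18 * N.divisors.card ^ 2 := by
    rw [← Finset.card_image_of_injective F hinj]
    refine card_rep_le_of_squarefree ha0 (Int.squarefree_natCast.mpr ha) hN0 _ ?_
    intro u hu
    obtain ⟨v, hv, rfl⟩ := Finset.mem_image.mp hu
    rw [← hF v hv, ← hab]
    push_cast
    ring
  have h2 := hc N hN0
  have h3 : (((N : ℤ) : ℝ)) ^ ε = ((N : ℝ) ^ (ε / 2)) ^ 2 := by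
    rw [← Real.rpow_natCast, ← Real.rpow_mul (by positivity)]
    norm_num
  rw [h3]
  calc (F.card : ℝ) ≤ 18 * (N.divisors.card : ℝ) ^ 2 := by exact_mod_cast h1
    _ ≤ 18 * (c * (N : ℝ) ^ (ε / 2)) ^ 2 := by gcongr
    _ = _ := by ring

/-- Points on a definite conic `δ X² + 4 E Y² + f Y + g = 0` are few, uniformly in the conic. -/
theorem exists_card_ellipse_le_rpow {ε : ℝ} (hε : 0 < ε) :
    ∃ c : ℝ, 0 < c ∧ ∀ (δ E f g : ℤ) (M : ℝ), 0 < δ → 0 < E → 1 ≤ M →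
      ((f ^ 2 - 16 * E * g : ℤ) : ℝ) ≤ M → ∀ F : Finset (ℤ × ℤ),
      (∀ v ∈ F, δ * v.1 ^ 2 + 4 * E * v.2 ^ 2 + f * v.2 + g = 0) →
      (F.card : ℝ) ≤ c * M ^ ε := by
  obtain ⟨c, hc0, hc⟩ := exists_card_rep_le_rpow hε
  refine ⟨c + 1, by positivity, fun δ E f g M hδ hE hM hN F hF => ?_⟩
  have hE' : 8 * E ≠ 0 := by positivity
  have hMε : 1 ≤ M ^ ε := Real.one_le_rpow hM hε.le
  set N := f ^ 2 - 16 * E * g with hNdef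
  have hinj : Function.Injective fun v : ℤ × ℤ => (8 * E * v.2 + f, v.1) := by
    intro v w he
    simp only [Prod.mk.injEq, add_left_inj] at he
    exact Prod.ext he.2 (mul_left_cancel₀ hE' he.1)
  have hrep : ∀ u ∈ F.image fun v : ℤ × ℤ => (8 * E * v.2 + f, v.1),
      u.1 ^ 2 + (16 * E * δ) * u.2 ^ 2 = N := by
    intro u hu
    obtain ⟨v, hv, rfl⟩ := Finset.mem_image.mp hu
    simp only [hNdef]
    linear_combination (16 * E) * hF v hv
  have hk : 0 < 16 * E * δ := by positivity
  rw [← Finset.card_image_of_injective F hinj]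
  rcases lt_or_ge 0 N with h | h
  · calc _ ≤ c * (N : ℝ) ^ ε := hc _ N hk h _ hrep
      _ ≤ c * M ^ ε := by gcongr
      _ ≤ (c + 1) * M ^ ε := by nlinarith
  · have : (F.image fun v : ℤ × ℤ => (8 * E * v.2 + f, v.1)).card ≤ 1 := by
      refine Finset.card_le_one.mpr fun u hu w hw => ?_
      have zero {u : ℤ × ℤ} (h' : u.1 ^ 2 + (16 * E * δ) * u.2 ^ 2 = N) : u = 0 := by
        have h1 := mul_nonneg hk.le (sq_nonneg u.2)
        have h2 : u.1 ^ 2 = 0 := by nlinarith [sq_nonneg u.1]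
        have h3 : (16 * E * δ) * u.2 ^ 2 = 0 := by nlinarith [sq_nonneg u.1]
        rw [mul_eq_zero, or_iff_right hk.ne'] at h3
        exact Prod.ext (pow_eq_zero_iff two_ne_zero |>.mp h2) (pow_eq_zero_iff two_ne_zero |>.mp h3)
      rw [zero (hrep u hu), zero (hrep w hw)]
    have : ((F.image fun v : ℤ × ℤ => (8 * E * v.2 + f, v.1)).card : ℝ) ≤ 1 := by
      exact_mod_cast this
    nlinarith

theorem Finset.card_le_mul_card_of_fiber_le {α β : Type*} [DecidableEq β] {s : Finset α}
    {t : Finset β}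
    {f : α → β} {K : ℝ} (hf : ∀ a ∈ s, f a ∈ t)
    (hK : ∀ b ∈ t, ((s.filter fun a => f a = b).card : ℝ) ≤ K) : (s.card : ℝ) ≤ K * t.card := by
  rw [Finset.card_eq_sum_card_fiberwise hf, Nat.cast_sum, mul_comm, ← nsmul_eq_mul]
  exact Finset.sum_le_card_nsmul _ _ _ hK

theorem Int.card_le_of_pairwise_dvd_sub {r : ℤ} (hr : 0 < r) {T : ℝ} (hT : 0 ≤ T) (F : Finset ℤ)
    (hF : ∀ x ∈ F, |(x : ℝ)| ≤ T) (hd : ∀ x ∈ F, ∀ y ∈ F, r ∣ x - y) :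
    (F.card : ℝ) ≤ 2 * T / r + 1 := by
  have hr' : (0 : ℝ) < r := by exact_mod_cast hr
  rcases F.eq_empty_or_nonempty with rfl | hne
  · simp; positivity
  set x₀ := F.min' hne
  have hx₀ : x₀ ∈ F := F.min'_mem hne
  have h1 : F.card ≤ (Finset.Icc 0 ⌊2 * T / r⌋).card := by
    refine Finset.card_le_card_of_injOn (fun x => (x - x₀) / r) ?_ ?_
    · intro x hx
      have hx' : x₀ ≤ x := F.min'_le x hx
      simp only [Finset.coe_Icc, Set.mem_Icc]
      refine ⟨Int.ediv_nonneg (by linarith) hr.le, Int.le_floor.mpr ?_⟩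
      obtain ⟨k, hk⟩ := hd x hx x₀ hx₀
      rw [hk, Int.mul_ediv_cancel_left _ hr.ne', le_div_iff₀ hr']
      have h2 : ((x - x₀ : ℤ) : ℝ) = r * k := by rw [hk]; push_cast; ring
      push_cast at h2
      linarith [abs_le.mp (hF x hx), abs_le.mp (hF x₀ hx₀)]
    · intro x hx y hy he
      have := (Int.ediv_left_inj (hd x hx x₀ hx₀) (hd y hy x₀ hx₀)).mp he
      linarith
  have h2 : 0 ≤ ⌊2 * T / r⌋ := Int.floor_nonneg.mpr (by positivity)
  have h3 : (F.card : ℤ) ≤ ⌊2 * T / r⌋ + 1 := by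
    rw [Int.card_Icc] at h1
    omega
  calc (F.card : ℝ) ≤ ⌊2 * T / r⌋ + 1 := by exact_mod_cast h3
    _ ≤ _ := by gcongr; exact Int.floor_le _

theorem Int.card_le_of_dvd_of_ne_zero {r : ℤ} (hr : 0 < r) {Z : ℝ} (hZ : 0 ≤ Z) (F : Finset ℤ)
    (hF : ∀ x ∈ F, |(x : ℝ)| ≤ Z) (hd : ∀ x ∈ F, r ∣ x) (h0 : ∀ x ∈ F, x ≠ 0) :
    (F.card : ℝ) ≤ 2 * Z / r := by
  have hr' : (0 : ℝ) < r := by exact_mod_cast hr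
  have h0F : (0 : ℤ) ∉ F := fun h => h0 0 h rfl
  have h1 := Int.card_le_of_pairwise_dvd_sub hr hZ (insert 0 F)
    (fun x hx => by
      rcases Finset.mem_insert.mp hx with rfl | hx
      · simpa using hZ
      · exact hF x hx)
    (fun x hx y hy => by
      have (x : ℤ) (hx : x ∈ insert 0 F) : r ∣ x := by
        rcases Finset.mem_insert.mp hx with rfl | hx
        · exact dvd_zero _
        · exact hd x hx
      exact dvd_sub (this x hx) (this y hy))
  rw [Finset.card_insert_of_notMem h0F] at h1
  push_cast at h1
  linarith

/-- Count of vectors `(z, w)` in a box, `z ≠ 0`, divisible by `p^j` and proportional to `(A, B)`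
modulo `p^e`. -/
theorem card_proportional_le {p : ℕ} (hp : p.Prime) {A B u v : ℤ} {e j : ℕ} (hj : j ≤ e)
    (huv : (p : ℤ) ^ e ∣ u * A + v * B - 1) {Z W : ℝ} (hZ : 0 ≤ Z) (hW : 0 ≤ W)
    (F : Finset (ℤ × ℤ))
    (hF : ∀ x ∈ F, x.1 ≠ 0 ∧ |(x.1 : ℝ)| ≤ Z ∧ |(x.2 : ℝ)| ≤ W ∧ (p : ℤ) ^ j ∣ x.1 ∧
      (p : ℤ) ^ j ∣ x.2 ∧ (p : ℤ) ^ e ∣ A * x.2 - B * x.1) :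
    (F.card : ℝ) ≤ 2 * Z / (p : ℝ) ^ j * (2 * W / (p : ℝ) ^ e + 1) := by
  have hp0 : (0 : ℤ) < p := by exact_mod_cast hp.pos
  have hp0' : (0 : ℝ) < p := by exact_mod_cast hp.pos
  obtain ⟨i, rfl⟩ := Nat.exists_eq_add_of_le hj
  set g : ℤ := (Int.gcd A ((p : ℤ) ^ i) : ℤ) with hg
  have hgA : g ∣ A := Int.gcd_dvd_left _ _
  have hgp : g ∣ (p : ℤ) ^ i := Int.gcd_dvd_right _ _
  have hg0 : 0 < g := by
    have : Int.gcd A ((p : ℤ) ^ i) ≠ 0 := by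
      rw [Ne, Int.gcd_eq_zero_iff]
      exact fun h => (pow_pos hp0 i).ne' h.2
    omega
  have hg1 : (1 : ℝ) ≤ g := by exact_mod_cast hg0
  obtain ⟨r, hr⟩ := hgp
  have hr0 : 0 < r := pos_of_mul_pos_right (hr ▸ pow_pos hp0 i) hg0.le
  have hpe : (p : ℤ) ^ (j + i) = g * (p ^ j * r) := by rw [pow_add, hr]; ring
  have himg : ((F.image Prod.fst).card : ℝ) ≤ 2 * Z / ((p ^ j * g : ℤ) : ℝ) := by
    refine Int.card_le_of_dvd_of_ne_zero (by positivity) hZ _ ?_ ?_ ?_ <;>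
    · intro z hz
      obtain ⟨x, hx, rfl⟩ := Finset.mem_image.mp hz
      obtain ⟨h1, h2, h3, ⟨a, ha⟩, ⟨b, hb⟩, h6⟩ := hF x hx
      first
      | exact h1
      | exact h2
      | rw [ha, hb, pow_add] at h6
        have h7 : (p : ℤ) ^ i ∣ A * b - B * a := by
          refine Int.dvd_of_mul_dvd_mul_left (pow_pos hp0 j).ne' (h6.trans (dvd_of_eq ?_))
          ring
        have h8 : g ∣ B * a := by
          have := dvd_sub (hgA.mul_right b) ((Dvd.intro _ hr.symm).trans h7)
          simpa using this
        have h9 : g ∣ u * A + v * B - 1 := (hpe ▸ dvd_mul_right g _).trans huv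
        have h10 : g ∣ a := by
          have : a = A * (u * a) + v * (B * a) - (u * A + v * B - 1) * a := by ring
          rw [this]
          exact dvd_sub (dvd_add (hgA.mul_right _) (h8.mul_left _)) (h9.mul_right _)
        rw [ha]
        exact mul_dvd_mul_left _ h10
  have hfib : ∀ z ∈ F.image Prod.fst, ((F.filter fun x => x.1 = z).card : ℝ) ≤
      2 * W / ((p ^ j * r : ℤ) : ℝ) + 1 := by
    intro z _
    rw [← Finset.card_image_of_injOn (f := Prod.snd) (s := F.filter fun x => x.1 = z)]
    · refine Int.card_le_of_pairwise_dvd_sub (by positivity) hW _ ?_ ?_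
      · intro w hw
        obtain ⟨x, hx, rfl⟩ := Finset.mem_image.mp hw
        exact (hF x (Finset.mem_filter.mp hx).1).2.2.1
      · intro w hw w' hw'
        obtain ⟨x, hx, rfl⟩ := Finset.mem_image.mp hw
        obtain ⟨x', hx', rfl⟩ := Finset.mem_image.mp hw'
        obtain ⟨hx, hxz⟩ := Finset.mem_filter.mp hx
        obtain ⟨hx', hxz'⟩ := Finset.mem_filter.mp hx'
        obtain ⟨-, -, -, -, h5, h6⟩ := hF x hx
        obtain ⟨-, -, -, -, h5', h6'⟩ := hF x' hx'
        rw [hxz] at h6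
        rw [hxz'] at h6'
        obtain ⟨c, hc⟩ := dvd_sub h5 h5'
        have h7 : (p : ℤ) ^ i ∣ A * c := by
          refine Int.dvd_of_mul_dvd_mul_left (pow_pos hp0 j).ne' ?_
          have := dvd_sub h6 h6'
          rw [pow_add] at this
          refine this.trans (dvd_of_eq ?_)
          linear_combination A * hc
        have h8 : (p : ℤ) ^ i ∣ g * c := by
          rw [hg, Int.gcd_eq_gcd_ab, add_mul]
          refine dvd_add ?_ ?_
          · rw [mul_right_comm]
            exact h7.mul_right _
          · rw [mul_assoc]
            exact dvd_mul_right _ _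
        rw [hr] at h8
        rw [hc]
        exact mul_dvd_mul_left _ (Int.dvd_of_mul_dvd_mul_left hg0.ne' h8)
    · intro x hx y hy he
      exact Prod.ext ((Finset.mem_filter.mp hx).2.trans (Finset.mem_filter.mp hy).2.symm) he
  have h1 := Finset.card_le_mul_card_of_fiber_le
    (fun x hx => Finset.mem_image_of_mem Prod.fst hx) hfib
  have hpe' : (p : ℝ) ^ (j + i) = g * (p ^ j * r) := by exact_mod_cast hpe
  have hr' : (0 : ℝ) < r := by exact_mod_cast hr0
  calc (F.card : ℝ) ≤ (2 * W / ((p ^ j * r : ℤ) : ℝ) + 1) * (2 * Z / ((p ^ j * g : ℤ) : ℝ)) :=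
        h1.trans (by gcongr)
    _ = 2 * Z / (p : ℝ) ^ j * (2 * W / (p : ℝ) ^ (j + i) + 1 / g) := by
        rw [hpe']
        push_cast
        field_simp
    _ ≤ _ := by
        gcongr
        rw [div_le_one (by positivity)]
        exact hg1

theorem exists_dvd_sub_or_dvd_add_of_pow_dvd_sq_sub_sq {p : ℕ} (hp : p.Prime) (hp2 : p ≠ 2)
    {e : ℕ} {t t₀ : ℤ}
    (h : (p : ℤ) ^ e ∣ t ^ 2 - t₀ ^ 2) :
    ∃ m, 2 * m ≤ e ∧ (p : ℤ) ^ m ∣ t₀ ∧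
      ((p : ℤ) ^ (e - m) ∣ t - t₀ ∨ (p : ℤ) ^ (e - m) ∣ t + t₀) := by
  have hodd (m : ℕ) : IsCoprime ((p : ℤ) ^ m) 2 := by
    refine IsCoprime.pow_left ?_
    exact_mod_cast Nat.isCoprime_iff_coprime.mpr ((Nat.coprime_primes hp Nat.prime_two).mpr hp2)
  have h' : p ^ e ∣ (t - t₀).natAbs * (t + t₀).natAbs := by
    rw [← Int.natAbs_mul, ← Int.natCast_dvd]
    push_cast
    convert h using 1
    ring
  obtain ⟨a, b, ha, hb, hab⟩ := exists_dvd_and_dvd_of_dvd_mul h'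
  obtain ⟨i, hi, rfl⟩ := (Nat.dvd_prime_pow hp).mp (Dvd.intro _ hab.symm)
  obtain ⟨k, hk, rfl⟩ := (Nat.dvd_prime_pow hp).mp (Dvd.intro_left _ hab.symm)
  rw [← pow_add] at hab
  obtain rfl := Nat.pow_right_injective hp.two_le hab
  rw [← Int.natCast_dvd] at ha hb
  push_cast at ha hb
  have hdiff {m : ℕ} (h1 : (p : ℤ) ^ m ∣ t - t₀) (h2 : (p : ℤ) ^ m ∣ t + t₀) :
      (p : ℤ) ^ m ∣ t₀ := by
    have := dvd_sub h2 h1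
    refine (hodd m).dvd_of_dvd_mul_left (this.trans (dvd_of_eq ?_))
    ring
  rcases le_total i k with hik | hik
  · refine ⟨i, by omega, hdiff ha ((pow_dvd_pow _ hik).trans hb), Or.inr ?_⟩
    simpa using hb
  · refine ⟨k, by omega, hdiff ((pow_dvd_pow _ hik).trans ha) hb, Or.inl ?_⟩
    simpa using ha

theorem pow_dvd_sub_or_dvd_add_of_coprime {p : ℕ} (hp : p.Prime) (hp2 : p ≠ 2) {j : ℕ} {x : ℤ}
    (h : (p : ℤ) ^ j ∣ 4 - x ^ 2) : (p : ℤ) ^ j ∣ x - 2 ∨ (p : ℤ) ^ j ∣ x + 2 := by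
  have hpz : Prime (p : ℤ) := Nat.prime_iff_prime_int.mp hp
  have h1 : (p : ℤ) ^ j ∣ (x - 2) * (x + 2) := by
    rw [show (x - 2) * (x + 2) = -(4 - x ^ 2) by ring, dvd_neg]
    exact h
  by_cases h2 : (p : ℤ) ∣ x - 2
  · left
    refine IsCoprime.dvd_of_dvd_mul_right (IsCoprime.pow_left ?_) h1
    refine (hpz.irreducible.coprime_iff_not_dvd).mpr fun h3 => ?_
    have h4 : (p : ℤ) ∣ (2 ^ 2 : ℕ) := by
      have := dvd_sub h3 h2
      rwa [show x + 2 - (x - 2) = ((2 ^ 2 : ℕ) : ℤ) by push_cast; ring] at this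
    have h5 := hp.dvd_of_dvd_pow (Int.natCast_dvd_natCast.mp h4)
    exact hp2 ((Nat.prime_dvd_prime_iff_eq hp Nat.prime_two).mp h5)
  · right
    exact (((hpz.irreducible.coprime_iff_not_dvd).mpr h2).pow_left).dvd_of_dvd_mul_left h1

/-- If `p ∤ 4AC - B²` then `A` and `B` generate the unit ideal modulo powers of `p`. -/
theorem exists_bezout_of_not_dvd_disc {p : ℕ} (hp : p.Prime) {A B C : ℤ}
    (hD : ¬ (p : ℤ) ∣ 4 * A * C - B ^ 2) (e : ℕ) :
    ∃ u v : ℤ, (p : ℤ) ^ e ∣ u * A + v * B - 1 := by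
  have hpz : Prime (p : ℤ) := Nat.prime_iff_prime_int.mp hp
  by_cases hA : (p : ℤ) ∣ A
  · have hB : ¬ (p : ℤ) ∣ B := fun hB => hD
      (dvd_sub ((hA.mul_left 4).mul_right C) (hB.trans (dvd_pow_self B two_ne_zero)))
    obtain ⟨a, b, hab⟩ := ((hpz.irreducible.coprime_iff_not_dvd).mpr hB).pow_left (m := e)
    exact ⟨0, b, -a, by linear_combination hab⟩
  · obtain ⟨a, b, hab⟩ := ((hpz.irreducible.coprime_iff_not_dvd).mpr hA).pow_left (m := e)
    exact ⟨b, 0, -a, by linear_combination hab⟩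

/-- Count of `(y₁, s, t)` satisfying the congruence constraints, away from `y₁ = ±2A`. -/
theorem card_congruence_triples_le {p : ℕ} (hp : p.Prime) (hp2 : p ≠ 2) {A B C : ℤ} {e : ℕ}
    (hA : 0 < A) (hBA : |B| ≤ A) (hD : ¬ (p : ℤ) ∣ 4 * A * C - B ^ 2) {S : ℝ} (hAS : (A : ℝ) ≤ S)
    (hpS : (p : ℝ) ^ e ≤ S) (G : Finset (ℤ × ℤ × ℤ))
    (hG : ∀ x ∈ G, |x.1| < 2 * A ∧ |(x.2.1 : ℝ)| ≤ S ∧ |(x.2.2 : ℝ)| ≤ S ∧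
      ∃ y : ℤ, (p : ℤ) ^ e ∣ C * x.1 - A * y ∧ (p : ℤ) ^ e ∣ C * x.2.1 - B * y ∧
        (p : ℤ) ^ e ∣ A * x.2.1 - B * x.1 ∧
        (p : ℤ) ^ e ∣ 4 * x.1 * y - x.2.1 ^ 2 + x.2.2 ^ 2 - 4 * (4 * A * C - B ^ 2)) :
    (G.card : ℝ) ≤ 1344 * A * (S / (p : ℝ) ^ e) ^ 2 := by
  have hpz : Prime (p : ℤ) := Nat.prime_iff_prime_int.mp hp
  have hp0 : (0 : ℝ) < p := by exact_mod_cast hp.pos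
  have hpz0 : (0 : ℤ) < p := by exact_mod_cast hp.pos
  have hA' : (0 : ℝ) < A := by exact_mod_cast hA
  have hS0 : 0 < S := hA'.trans_le hAS
  have hBS : |(B : ℝ)| ≤ S := le_trans (by exact_mod_cast hBA) hAS
  obtain ⟨u, v, huv⟩ := exists_bezout_of_not_dvd_disc hp hD e
  have hμ {y1 s t y : ℤ} (h1 : (p : ℤ) ^ e ∣ C * y1 - A * y) (h2 : (p : ℤ) ^ e ∣ C * s - B * y)
      (h3 : (p : ℤ) ^ e ∣ A * s - B * y1)
      (h4 : (p : ℤ) ^ e ∣ 4 * y1 * y - s ^ 2 + t ^ 2 - 4 * (4 * A * C - B ^ 2)) :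
      (p : ℤ) ^ e ∣ y1 - (u * y1 + v * s) * A ∧ (p : ℤ) ^ e ∣ s - (u * y1 + v * s) * B ∧
      (p : ℤ) ^ e ∣ t ^ 2 - (4 * A * C - B ^ 2) * (4 - (u * y1 + v * s) ^ 2) := by
    obtain ⟨k, hk⟩ := huv
    obtain ⟨k1, hk1⟩ := h1
    obtain ⟨k2, hk2⟩ := h2
    obtain ⟨k3, hk3⟩ := h3
    obtain ⟨k4, hk4⟩ := h4
    set μ := u * y1 + v * s with hμ
    have e1 : y1 - μ * A = (p : ℤ) ^ e * (-k * y1 - v * k3) := by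
      rw [hμ]; linear_combination (-y1) * hk - v * hk3
    have e2 : s - μ * B = (p : ℤ) ^ e * (-k * s + u * k3) := by
      rw [hμ]; linear_combination (-s) * hk + u * hk3
    have e3 : y - μ * C = (p : ℤ) ^ e * (-k * y - u * k1 - v * k2) := by
      rw [hμ]; linear_combination (-y) * hk - u * hk1 - v * hk2
    refine ⟨⟨_, e1⟩, ⟨_, e2⟩, ⟨k4 - 4 * (-k * y1 - v * k3) * y -
      4 * μ * A * (-k * y - u * k1 - v * k2) +
      (-k * s + u * k3) * (s + μ * B), ?_⟩⟩
    linear_combination hk4 - 4 * y * e1 - 4 * μ * A * e3 + (s + μ * B) * e2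
  have ex (q : ℤ × ℤ) : ∃ t : ℤ, (∃ t', (q.1, q.2, t') ∈ G) → (q.1, q.2, t) ∈ G := by
    by_cases h : ∃ t', (q.1, q.2, t') ∈ G
    · exact ⟨h.choose, fun _ => h.choose_spec⟩
    · exact ⟨0, fun h' => absurd h' h⟩
  choose T hT using ex
  let I : Finset (ℕ × ℤ × ℤ) := Finset.range (e / 2 + 1) ×ˢ ({1, -1} ×ˢ {1, -1} : Finset (ℤ × ℤ))
  let E (i : ℕ × ℤ × ℤ) : Finset (ℤ × ℤ × ℤ) := G.filter fun x =>
    (p : ℤ) ^ (2 * i.1) ∣ x.1 - 2 * i.2.1 * A ∧ (p : ℤ) ^ (2 * i.1) ∣ x.2.1 - 2 * i.2.1 * B ∧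
      (p : ℤ) ^ (e - i.1) ∣ x.2.2 - i.2.2 * T (x.1, x.2.1)
  have hcover : G ⊆ I.biUnion E := by
    rintro ⟨y1, s, t⟩ hx
    obtain ⟨-, -, -, y, h1, h2, h3, h4⟩ := hG _ hx
    have hx₀ := hT (y1, s) ⟨t, hx⟩
    obtain ⟨-, -, -, y', h1', h2', h3', h4'⟩ := hG _ hx₀
    simp only at h1 h2 h3 h4 h1' h2' h3' h4'
    obtain ⟨m1, m2, m3⟩ := hμ h1 h2 h3 h4
    obtain ⟨-, -, m3'⟩ := hμ h1' h2' h3' h4'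
    have h5 : (p : ℤ) ^ e ∣ t ^ 2 - T (y1, s) ^ 2 := by simpa using dvd_sub m3 m3'
    obtain ⟨m, hm, hmT, hmt⟩ := exists_dvd_sub_or_dvd_add_of_pow_dvd_sq_sub_sq hp hp2 h5
    have hpm : (p : ℤ) ^ (2 * m) ∣ (p : ℤ) ^ e := pow_dvd_pow _ hm
    have h6 : (p : ℤ) ^ (2 * m) ∣ 4 - (u * y1 + v * s) ^ 2 := by
      have h7 : (p : ℤ) ^ (2 * m) ∣ T (y1, s) ^ 2 := by
        rw [mul_comm, pow_mul]
        exact pow_dvd_pow_of_dvd hmT 2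
      have h8 := dvd_sub h7 (hpm.trans m3')
      rw [sub_sub_cancel] at h8
      exact (((hpz.irreducible.coprime_iff_not_dvd).mpr hD).pow_left).dvd_of_dvd_mul_left h8
    have hσ : ∃ σ ∈ ({1, -1} : Finset ℤ), (p : ℤ) ^ (2 * m) ∣ (u * y1 + v * s) - 2 * σ := by
      rcases pow_dvd_sub_or_dvd_add_of_coprime hp hp2 h6 with h | h
      · exact ⟨1, by simp, by simpa using h⟩
      · exact ⟨-1, by simp, by simpa using h⟩
    have hτ : ∃ τ ∈ ({1, -1} : Finset ℤ), (p : ℤ) ^ (e - m) ∣ t - τ * T (y1, s) := by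
      rcases hmt with h | h
      · exact ⟨1, by simp, by simpa using h⟩
      · exact ⟨-1, by simp, by simpa using h⟩
    obtain ⟨σ, hσI, hσ⟩ := hσ
    obtain ⟨τ, hτI, hτ⟩ := hτ
    refine Finset.mem_biUnion.mpr ⟨(m, σ, τ), ?_, ?_⟩
    · simp only [I, Finset.mem_product, Finset.mem_range]
      exact ⟨by omega, hσI, hτI⟩
    · simp only [E, Finset.mem_filter]
      refine ⟨hx, ?_, ?_, hτ⟩
      · refine (dvd_add (hpm.trans m1) (hσ.mul_right A)).trans (dvd_of_eq ?_)
        ring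
      · refine (dvd_add (hpm.trans m2) (hσ.mul_right B)).trans (dvd_of_eq ?_)
        ring
  have hE (i : ℕ × ℤ × ℤ) (hi : i ∈ I) :
      ((E i).card : ℝ) ≤ 168 * A * (S / (p : ℝ) ^ e) ^ 2 * (1 / 2) ^ i.1 := by
    obtain ⟨m, σ, τ⟩ := i
    simp only [I, Finset.mem_product, Finset.mem_range] at hi
    obtain ⟨hm, hσ, -⟩ := hi
    have hm2 : 2 * m ≤ e := by omega
    have hσ1 : |σ| = 1 := by
      rcases Finset.mem_insert.mp hσ with rfl | h
      · rfl
      · rw [Finset.mem_singleton.mp h]; rfl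
    have hσ1' : |(σ : ℝ)| = 1 := by exact_mod_cast hσ1
    let f : ℤ × ℤ × ℤ → ℤ × ℤ := fun x => (x.1 - 2 * σ * A, x.2.1 - 2 * σ * B)
    have himg := card_proportional_le hp hm2 huv (Z := 4 * A) (W := 3 * S) (by positivity)
      (by positivity) ((E (m, σ, τ)).image f) (by
        intro q hq
        obtain ⟨x, hx, rfl⟩ := Finset.mem_image.mp hq
        simp only [E, Finset.mem_filter] at hx
        obtain ⟨hxG, h1, h2, -⟩ := hx
        obtain ⟨g1, g2, -, y, -, -, g3, -⟩ := hG x hxG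
        have hσA : |2 * σ * A| = 2 * A := by
          rw [abs_mul, abs_mul, hσ1, abs_of_pos hA]; norm_num
        refine ⟨fun h0 => ?_, ?_, ?_, h1, h2, ?_⟩
        · have h0' : x.1 = 2 * σ * A := sub_eq_zero.mp h0
          rw [h0', hσA] at g1
          exact lt_irrefl _ g1
        · have := (abs_sub x.1 (2 * σ * A)).trans (add_le_add g1.le hσA.le)
          have h' : |x.1 - 2 * σ * A| ≤ 4 * A := by linarith
          exact_mod_cast h'
        · have hσB : |2 * (σ : ℝ) * B| ≤ 2 * S := by
            rw [abs_mul, abs_mul, hσ1']; norm_num; exact hBS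
          have := (abs_sub (x.2.1 : ℝ) (2 * σ * B)).trans (add_le_add g2 hσB)
          simp only [f]
          push_cast
          linarith
        · refine g3.trans (dvd_of_eq ?_)
          simp only [f]
          ring)
    have hfib : ∀ q ∈ (E (m, σ, τ)).image f, (((E (m, σ, τ)).filter fun x => f x = q).card : ℝ) ≤
        2 * S / (((p : ℤ) ^ (e - m) : ℤ) : ℝ) + 1 := by
      intro q _
      have inj : Set.InjOn (fun x : ℤ × ℤ × ℤ => x.2.2)
          ((E (m, σ, τ)).filter fun x => f x = q : Finset (ℤ × ℤ × ℤ)) := by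
        intro x hx y hy he
        have := (Finset.mem_filter.mp hx).2.trans (Finset.mem_filter.mp hy).2.symm
        simp only [f, Prod.mk.injEq, sub_left_inj] at this
        exact Prod.ext this.1 (Prod.ext this.2 he)
      rw [← Finset.card_image_of_injOn inj]
      refine Int.card_le_of_pairwise_dvd_sub (by positivity) hS0.le _ ?_ ?_
      · intro t ht
        obtain ⟨x, hx, rfl⟩ := Finset.mem_image.mp ht
        exact (hG x (Finset.mem_filter.mp (Finset.mem_filter.mp hx).1).1).2.2.1
      · intro t ht t' ht'
        obtain ⟨x, hx, rfl⟩ := Finset.mem_image.mp ht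
        obtain ⟨x', hx', rfl⟩ := Finset.mem_image.mp ht'
        obtain ⟨hxE, hxf⟩ := Finset.mem_filter.mp hx
        obtain ⟨hxE', hxf'⟩ := Finset.mem_filter.mp hx'
        have h1 := (Finset.mem_filter.mp hxE).2.2.2
        have h1' := (Finset.mem_filter.mp hxE').2.2.2
        have := hxf.trans hxf'.symm
        simp only [f, Prod.mk.injEq, sub_left_inj] at this
        rw [← this.1, ← this.2] at h1'
        simpa using dvd_sub h1 h1'
    have h1 := Finset.card_le_mul_card_of_fiber_le
      (fun x hx => Finset.mem_image_of_mem f hx) hfib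
    have hPm : (p : ℝ) ^ e = p ^ m * p ^ (e - m) := by
      rw [← pow_add]; congr 1; omega
    have hpm1 : (1 : ℝ) ≤ p ^ m := one_le_pow₀ (by exact_mod_cast hp.one_le)
    have b1 : 2 * S / (((p : ℤ) ^ (e - m) : ℤ) : ℝ) + 1 ≤ 3 * (S / p ^ e) * p ^ m := by
      have : 1 ≤ S / (p : ℝ) ^ (e - m) := by
        rw [one_le_div (by positivity)]
        refine le_trans ?_ hpS
        rw [hPm]
        exact le_mul_of_one_le_left (by positivity) hpm1
      have e1 : 3 * (S / p ^ e) * p ^ m = 3 * (S / (p : ℝ) ^ (e - m)) := by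
        rw [hPm]; field_simp
      rw [e1]
      push_cast
      rw [mul_div_assoc]
      linarith
    have b2 : 2 * (3 * S) / (p : ℝ) ^ e + 1 ≤ 7 * (S / p ^ e) := by
      have : 1 ≤ S / (p : ℝ) ^ e := (one_le_div (by positivity)).mpr hpS
      have : 2 * (3 * S) / (p : ℝ) ^ e = 6 * (S / p ^ e) := by ring
      linarith
    have b3 : 1 / (p : ℝ) ^ m ≤ (1 / 2) ^ m := by
      rw [_root_.one_div_pow]
      gcongr
      exact_mod_cast hp.two_le
    calc ((E (m, σ, τ)).card : ℝ)
        ≤ (3 * (S / p ^ e) * p ^ m) * (2 * (4 * A) / (p : ℝ) ^ (2 * m) * (7 * (S / p ^ e))) :=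
          h1.trans (mul_le_mul b1 (himg.trans (by gcongr)) (by positivity) (by positivity))
      _ = 168 * A * (S / (p : ℝ) ^ e) ^ 2 * (1 / (p : ℝ) ^ m) := by
          rw [two_mul m, pow_add]; field_simp; ring
      _ ≤ _ := by gcongr
  have hgeom : ∑ m ∈ Finset.range (e / 2 + 1), (1 / 2 : ℝ) ^ m ≤ 2 := by
    have h := summable_geometric_two.sum_le_tsum (Finset.range (e / 2 + 1))
      (fun _ _ => by positivity)
    rwa [tsum_geometric_two] at h
  calc (G.card : ℝ) ≤ ∑ i ∈ I, ((E i).card : ℝ) := by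
        exact_mod_cast (Finset.card_le_card hcover).trans Finset.card_biUnion_le
    _ ≤ ∑ i ∈ I, 168 * A * (S / (p : ℝ) ^ e) ^ 2 * (1 / 2) ^ i.1 := Finset.sum_le_sum hE
    _ = 168 * A * (S / (p : ℝ) ^ e) ^ 2 * 4 * ∑ m ∈ Finset.range (e / 2 + 1), (1 / 2 : ℝ) ^ m := by
        simp only [I]
        rw [Finset.sum_product, Finset.mul_sum]
        refine Finset.sum_congr rfl fun m _ => ?_
        simp only [Finset.sum_const]
        have : (({1, -1} ×ˢ {1, -1} : Finset (ℤ × ℤ))).card = 4 := rfl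
        rw [this, nsmul_eq_mul]
        push_cast
        ring
    _ ≤ 168 * A * (S / (p : ℝ) ^ e) ^ 2 * 4 * 2 := by gcongr
    _ = _ := by ring

/-- The conditions defining `𝒮(n)` in terms of the integers `yᵢ = 2xᵢ`, with `δ = 16 disc(Q)` and
modulus `p^e`. -/
structure SMemInt (δ A B C : ℤ) (p e : ℕ) (y : Fin 5 → ℤ) : Prop where
  eqn : δ * y 0 ^ 2 = 4 * (y 1 * y 4 - y 2 * y 3 - (4 * A * C - B ^ 2)) ^ 2 -
    16 * (C * y 1 - A * y 4) ^ 2 -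
    16 * ((B * y 1 - A * (y 2 + y 3)) * (B * y 4 - C * (y 2 + y 3)))
  abs_one_le : |y 1| ≤ 2 * A
  abs_four_le : |y 4| ≤ 2 * C
  sq_two_le : y 2 ^ 2 ≤ 4 * (A * C)
  sq_three_le : y 3 ^ 2 ≤ 4 * (A * C)
  dvd_det : (p : ℤ) ^ e ∣ y 1 * y 4 - y 2 * y 3 - (4 * A * C - B ^ 2)
  dvd_AC : (p : ℤ) ^ e ∣ C * y 1 - A * y 4
  dvd_BC : (p : ℤ) ^ e ∣ C * (y 2 + y 3) - B * y 4
  dvd_AB : (p : ℤ) ^ e ∣ A * (y 2 + y 3) - B * y 1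
  boundary : ∀ σ : ℤ, σ = 1 ∨ σ = -1 → y 1 = 2 * σ * A →
    y 0 = 0 ∧ y 2 = σ * B ∧ y 3 = σ * B

theorem Int.dvd_of_dvd_mul_of_bezout {m u v A B z : ℤ} (huv : m ∣ u * A + v * B - 1)
    (hA : m ∣ A * z) (hB : m ∣ B * z) : m ∣ z := by
  have : z = u * (A * z) + v * (B * z) - (u * A + v * B - 1) * z := by ring
  rw [this]
  exact dvd_sub (dvd_add (hA.mul_left _) (hB.mul_left _)) (huv.mul_right _)

/-- Count of tuples with `y₁ = ±2A`. -/
theorem card_boundary_one_le {δ A B C : ℤ} {p e : ℕ} (hp : p.Prime) (hC : 0 < C)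
    (hD : ¬ (p : ℤ) ∣ 4 * A * C - B ^ 2) {σ : ℤ} (hσ : σ = 1 ∨ σ = -1)
    (I : Finset (Fin 5 → ℤ)) (hI : ∀ y ∈ I, SMemInt δ A B C p e y ∧ y 1 = 2 * σ * A) :
    (I.card : ℝ) ≤ 4 * C / (p : ℝ) ^ e + 1 := by
  obtain ⟨u, v, huv⟩ := exists_bezout_of_not_dvd_disc hp hD e
  have hp0 : (0 : ℤ) < p := by exact_mod_cast hp.pos
  have hC' : (0 : ℝ) < C := by exact_mod_cast hC
  have inj : Set.InjOn (fun y : Fin 5 → ℤ => y 4) I := by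
    intro y hy z hz he
    obtain ⟨h1, h2⟩ := hI y hy
    obtain ⟨h1', h2'⟩ := hI z hz
    obtain ⟨a, b, c⟩ := h1.boundary σ hσ h2
    obtain ⟨a', b', c'⟩ := h1'.boundary σ hσ h2'
    funext i
    fin_cases i
    · exact a.trans a'.symm
    · exact h2.trans h2'.symm
    · exact b.trans b'.symm
    · exact c.trans c'.symm
    · exact he
  have key {y : Fin 5 → ℤ} (hy : y ∈ I) : (p : ℤ) ^ e ∣ y 4 - 2 * σ * C := by
    obtain ⟨h1, h2⟩ := hI y hy
    obtain ⟨-, b, c⟩ := h1.boundary σ hσ h2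
    refine Int.dvd_of_dvd_mul_of_bezout huv ?_ ?_
    · rw [← dvd_neg]
      refine h1.dvd_AC.trans (dvd_of_eq ?_)
      rw [h2]; ring
    · rw [← dvd_neg]
      refine h1.dvd_BC.trans (dvd_of_eq ?_)
      rw [b, c]; ring
  rw [← Finset.card_image_of_injOn inj]
  have := Int.card_le_of_pairwise_dvd_sub (pow_pos hp0 e) (T := 2 * C) (by positivity)
    (I.image fun y : Fin 5 → ℤ => y 4) (by
      intro x hx
      obtain ⟨y, hy, rfl⟩ := Finset.mem_image.mp hx
      exact_mod_cast (hI y hy).1.abs_four_le) (by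
      intro x hx x' hx'
      obtain ⟨y, hy, rfl⟩ := Finset.mem_image.mp hx
      obtain ⟨y', hy', rfl⟩ := Finset.mem_image.mp hx'
      simpa using dvd_sub (key hy) (key hy'))
  refine this.trans_eq ?_
  push_cast
  ring

/-- The discriminant of the conic in `(y₀, y₄)` cut out by fixing `y₁, y₂, y₃` is polynomially
bounded. -/
theorem conic_disc_le {A B C y1 y2 y3 : ℤ} (hA : 0 < A) (hBA : |B| ≤ A) (hAC : A ≤ C)
    (h1 : |y1| ≤ 2 * A) (h2 : y2 ^ 2 ≤ 4 * (A * C)) (h3 : y3 ^ 2 ≤ 4 * (A * C)) :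
    (8 * y1 * (y2 * y3 + (4 * A * C - B ^ 2)) - 32 * (A * C) * y1 +
        16 * (B * y1 - A * (y2 + y3)) * B) ^ 2 -
      16 * (4 * A ^ 2 - y1 ^ 2) * (16 * C ^ 2 * y1 ^ 2 -
        4 * (y2 * y3 + (4 * A * C - B ^ 2)) ^ 2 -
        16 * (B * y1 - A * (y2 + y3)) * (C * (y2 + y3))) ≤ 200000 * (A * C) ^ 6 := by
  have hC : 0 < C := hA.trans_le hAC
  set H := A * C with hH
  have hAH : A ≤ H := by nlinarith
  have hCH : C ≤ H := by nlinarith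
  have hH1 : 1 ≤ H := by linarith
  have hBH : |B| ≤ H := hBA.trans hAH
  have hy1 : |y1| ≤ 2 * H := by linarith
  have hB2 : B ^ 2 ≤ H := by
    rw [← sq_abs]; nlinarith [abs_nonneg B]
  have hy2 : |y2| ≤ 2 * H := abs_le_of_sq_le_sq (by nlinarith) (by linarith)
  have hy3 : |y3| ≤ 2 * H := abs_le_of_sq_le_sq (by nlinarith) (by linarith)
  have hs : |y2 + y3| ≤ 4 * H := (abs_add_le _ _).trans (by linarith)
  have hyy : |y2 * y3| ≤ 4 * H := by
    rw [abs_le]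
    constructor <;> nlinarith [sq_nonneg (y2 + y3), sq_nonneg (y2 - y3)]
  have hk : |y2 * y3 + (4 * A * C - B ^ 2)| ≤ 8 * H := by
    have := abs_le.mp hyy
    rw [abs_le]
    constructor <;> nlinarith [sq_nonneg B]
  have mulb {a b α β : ℤ} (ha : |a| ≤ α) (hb : |b| ≤ β) : |a * b| ≤ α * β := by
    rw [abs_mul]
    exact mul_le_mul ha hb (abs_nonneg _) ((abs_nonneg _).trans ha)
  have subb {a b α β : ℤ} (ha : |a| ≤ α) (hb : |b| ≤ β) : |a - b| ≤ α + β :=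
    (abs_sub _ _).trans (add_le_add ha hb)
  have hA' : |A| ≤ H := by rwa [abs_of_pos hA]
  have hC' : |C| ≤ H := by rwa [abs_of_pos hC]
  have hb : |B * y1 - A * (y2 + y3)| ≤ 6 * H ^ 2 :=
    (subb (mulb hBH hy1) (mulb hA' hs)).trans_eq (by ring)
  have hy1A : y1 ^ 2 ≤ 4 * A ^ 2 := by rw [← sq_abs]; nlinarith [abs_nonneg y1]
  have hA2 : A ^ 2 ≤ H ^ 2 := by gcongr
  generalize B * y1 - A * (y2 + y3) = b at hb ⊢
  generalize y2 + y3 = s at hs ⊢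
  generalize y2 * y3 + (4 * A * C - B ^ 2) = k at hk ⊢
  clear_value H
  have p2 : H ^ 2 ≤ H ^ 3 := pow_le_pow_right₀ hH1 (by norm_num)
  have p3 : H ^ 2 ≤ H ^ 4 := pow_le_pow_right₀ hH1 (by norm_num)
  have hf : |8 * y1 * k - 32 * H * y1 + 16 * b * B| ≤ 300 * H ^ 3 := by
    have t1 := abs_le.mp (mulb hy1 hk)
    have t2 := abs_le.mp (mulb (a := H) (abs_of_pos (by linarith)).le hy1)
    have t3 := abs_le.mp (mulb hb hBH)
    rw [abs_le]
    constructor <;> linarith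
  have hg : |16 * C ^ 2 * y1 ^ 2 - 4 * k ^ 2 - 16 * b * (C * s)| ≤ 704 * H ^ 4 := by
    have t1 := abs_le.mp (mulb (mulb hC' hy1) (mulb hC' hy1))
    have t2 := abs_le.mp (mulb hk hk)
    have t3 := abs_le.mp (mulb hb (mulb hC' hs))
    rw [abs_le]
    constructor <;> linarith
  have he : |4 * A ^ 2 - y1 ^ 2| ≤ 4 * H ^ 2 := by
    rw [abs_of_nonneg (by linarith)]
    linarith [sq_nonneg y1]
  generalize 8 * y1 * k - 32 * H * y1 + 16 * b * B = f at hf ⊢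
  generalize 16 * C ^ 2 * y1 ^ 2 - 4 * k ^ 2 - 16 * b * (C * s) = g at hg ⊢
  generalize 4 * A ^ 2 - y1 ^ 2 = a at he ⊢
  have t1 := abs_le.mp (mulb hf hf)
  have t2 := abs_le.mp (mulb he hg)
  have hpp : 0 ≤ H ^ 6 := by positivity
  linarith

/-- The count of `𝒮(n)` in integral coordinates. -/
theorem exists_card_SMemInt_le {δ : ℤ} (hδ : 0 < δ) {p : ℕ} (hp : p.Prime) (hp2 : p ≠ 2) {ε : ℝ}
    (hε : 0 < ε) :
    ∃ κ : ℝ, 0 < κ ∧ ∀ (A B C : ℤ) (e : ℕ) (D : ℝ), 0 < A → |B| ≤ A → A ≤ C →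
      ((4 * A * C - B ^ 2 : ℤ) : ℝ) = 4 * D → ¬ (p : ℤ) ∣ 4 * A * C - B ^ 2 →
      (p : ℝ) ^ e ≤ √D → ∀ I : Finset (Fin 5 → ℤ), (∀ y ∈ I, SMemInt δ A B C p e y) →
      (I.card : ℝ) ≤ κ * (A * D ^ ((3 : ℝ) / 2 + ε) / ((p : ℝ) ^ e) ^ 3 + C / (p : ℝ) ^ e) := by
  obtain ⟨c, hc0, hc⟩ := exists_card_ellipse_le_rpow (show 0 < ε / 6 by positivity)
  set c₁ : ℝ := c * (200000 ^ (ε / 6) * (4 / 3) ^ ε) * (1344 * 16 * (4 / 3)) with hc₁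
  have hc₁0 : 0 < c₁ := by positivity
  refine ⟨c₁ + 20, by positivity, fun A B C e D hA hBA hAC hDe hD hpD I hI => ?_⟩
  have hp0 : (0 : ℝ) < p := by exact_mod_cast hp.pos
  have hP0 : (0 : ℝ) < (p : ℝ) ^ e := by positivity
  set P : ℝ := (p : ℝ) ^ e with hP
  have hC : 0 < C := hA.trans_le hAC
  have hA' : (1 : ℝ) ≤ A := by exact_mod_cast hA
  have hC' : (1 : ℝ) ≤ C := by exact_mod_cast hC
  have hAC' : (A : ℝ) ≤ C := by exact_mod_cast hAC
  have hB2 : B ^ 2 ≤ A ^ 2 := sq_le_sq.mpr (by rwa [abs_of_pos hA])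
  have hB2' : (B : ℝ) ^ 2 ≤ (A : ℝ) ^ 2 := by exact_mod_cast hB2
  push_cast at hDe
  have hHD : (A : ℝ) * C ≤ 4 / 3 * D := by nlinarith
  have hDH : D ≤ (A : ℝ) * C := by nlinarith [sq_nonneg (B : ℝ)]
  have hH1 : (1 : ℝ) ≤ (A : ℝ) * C := by nlinarith
  have hD0 : 0 < D := by linarith
  have hPC : P ≤ C := by
    refine hpD.trans (Real.sqrt_le_iff.mpr ⟨by linarith, ?_⟩)
    nlinarith
  set S : ℝ := 4 * √((A : ℝ) * C) with hS
  have hS2 : S ^ 2 = 16 * (A * C) := by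
    rw [hS, mul_pow, Real.sq_sqrt (by positivity)]; norm_num
  have hAS : (A : ℝ) ≤ S := by
    have : (A : ℝ) ≤ √((A : ℝ) * C) := Real.le_sqrt_of_sq_le (by nlinarith)
    linarith
  have hPS : P ≤ S := by
    have := Real.sqrt_le_sqrt hDH
    have := Real.sqrt_nonneg ((A : ℝ) * C)
    linarith
  have hB1 (σ : ℤ) (hσ : σ = 1 ∨ σ = -1) :
      ((I.filter fun y => y 1 = 2 * σ * A).card : ℝ) ≤ 5 * (C / P) := by
    have h1 := card_boundary_one_le hp hC hD hσ (I.filter fun y => y 1 = 2 * σ * A)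
      (fun y hy => ⟨hI y (Finset.mem_filter.mp hy).1, (Finset.mem_filter.mp hy).2⟩)
    have h2 : 1 ≤ C / P := (one_le_div hP0).mpr hPC
    rw [← hP, mul_div_assoc] at h1
    linarith
  set J := I.filter fun y => |y 1| < 2 * A with hJ
  have hcover : I ⊆ J ∪ ((I.filter fun y => y 1 = 2 * 1 * A) ∪
      (I.filter fun y => y 1 = 2 * (-1) * A)) := by
    intro y hy
    have := (hI y hy).abs_one_le
    simp only [hJ, Finset.mem_union, Finset.mem_filter, hy, true_and]
    rcases this.lt_or_eq with h | h
    · exact Or.inl h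
    · right
      rcases abs_choice (y 1) with h' | h' <;> rw [h'] at h
      · left; linarith
      · right; linarith
  have hIJ : (I.card : ℝ) ≤ J.card + 10 * (C / P) := by
    have h1 : I.card ≤ _ := (Finset.card_le_card hcover).trans ((Finset.card_union_le _ _).trans
      (Nat.add_le_add_left (Finset.card_union_le _ _) _))
    have h2 : (I.card : ℝ) ≤ J.card + ((I.filter fun y => y 1 = 2 * 1 * A).card +
      (I.filter fun y => y 1 = 2 * (-1) * A).card) := by exact_mod_cast h1
    exact h2.trans ((add_le_add le_rfl (add_le_add (hB1 1 (Or.inl rfl))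
      (hB1 (-1) (Or.inr rfl)))).trans_eq (by ring))
  let f : (Fin 5 → ℤ) → ℤ × ℤ × ℤ := fun y => (y 1, y 2 + y 3, y 2 - y 3)
  have hsqrt {z : ℤ} (hz : z ^ 2 ≤ 4 * (A * C)) : |(z : ℝ)| ≤ S / 2 := by
    refine abs_le_of_sq_le_sq ?_ (by positivity)
    have : (z : ℝ) ^ 2 ≤ 4 * (A * C) := by exact_mod_cast hz
    rw [div_pow, hS2]
    linarith
  have himg : ((J.image f).card : ℝ) ≤ 1344 * A * (S / P) ^ 2 := by
    refine card_congruence_triples_le hp hp2 hA hBA hD hAS hPS _ ?_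
    intro x hx
    obtain ⟨y, hy, rfl⟩ := Finset.mem_image.mp hx
    obtain ⟨hyI, hy1⟩ := Finset.mem_filter.mp hy
    have h := hI y hyI
    have h2 := hsqrt h.sq_two_le
    have h3 := hsqrt h.sq_three_le
    simp only [f]
    push_cast
    refine ⟨hy1, (abs_add_le _ _).trans (by linarith), (abs_sub _ _).trans (by linarith),
      y 4, h.dvd_AC, h.dvd_BC, h.dvd_AB, ?_⟩
    refine (h.dvd_det.mul_left 4).trans (dvd_of_eq ?_)
    ring
  set M : ℝ := 200000 * ((A : ℝ) * C) ^ 6 with hM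
  have hM1 : 1 ≤ M := by
    have := one_le_pow₀ hH1 (n := 6)
    linarith
  have hfib : ∀ q ∈ J.image f, ((J.filter fun y => f y = q).card : ℝ) ≤ c * M ^ (ε / 6) := by
    intro q hq
    obtain ⟨z, hz, rfl⟩ := Finset.mem_image.mp hq
    obtain ⟨hzI, hz1⟩ := Finset.mem_filter.mp hz
    have h := hI z hzI
    have hf {y : Fin 5 → ℤ} (hy : y ∈ J.filter fun y => f y = f z) :
        y 1 = z 1 ∧ y 2 = z 2 ∧ y 3 = z 3 := by
      have := (Finset.mem_filter.mp hy).2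
      simp only [f, Prod.mk.injEq] at this
      omega
    have inj : Set.InjOn (fun y : Fin 5 → ℤ => (y 0, y 4))
        (J.filter fun y => f y = f z : Finset (Fin 5 → ℤ)) := by
      intro y hy y' hy' he
      obtain ⟨a, b, d⟩ := hf hy
      obtain ⟨a', b', d'⟩ := hf hy'
      simp only [Prod.mk.injEq] at he
      funext i
      fin_cases i
      · exact he.1
      · exact a.trans a'.symm
      · exact b.trans b'.symm
      · exact d.trans d'.symm
      · exact he.2
    rw [← Finset.card_image_of_injOn inj]
    have hE : 0 < 4 * A ^ 2 - z 1 ^ 2 := by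
      have := sq_lt_sq' (by linarith [abs_nonneg (z 1)]) hz1
      rw [sq_abs] at this
      nlinarith
    have hdisc := conic_disc_le hA hBA hAC h.abs_one_le h.sq_two_le h.sq_three_le
    refine hc δ (4 * A ^ 2 - z 1 ^ 2) _ _ M hδ hE hM1 (by rw [hM]; exact_mod_cast hdisc) _ ?_
    intro v hv
    obtain ⟨y, hy, rfl⟩ := Finset.mem_image.mp hv
    obtain ⟨a, b, d⟩ := hf hy
    have heq := (hI y (Finset.mem_filter.mp (Finset.mem_filter.mp hy).1).1).eqn
    rw [a, b, d] at heq
    simp only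
    linear_combination heq
  have hJ1 := Finset.card_le_mul_card_of_fiber_le
    (fun y hy => Finset.mem_image_of_mem f hy) hfib
  have hMε : M ^ (ε / 6) ≤ 200000 ^ (ε / 6) * (4 / 3) ^ ε * D ^ ε := by
    have h1 : M ≤ 200000 * (4 / 3 * D) ^ 6 := by rw [hM]; gcongr
    calc M ^ (ε / 6) ≤ (200000 * (4 / 3 * D) ^ 6) ^ (ε / 6) := by gcongr
      _ = 200000 ^ (ε / 6) * (4 / 3 * D) ^ ε := by
        rw [Real.mul_rpow (by positivity) (by positivity), ← Real.rpow_natCast (4 / 3 * D) 6,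
          ← Real.rpow_mul (by positivity)]
        congr 2
        push_cast
        ring
      _ = _ := by rw [Real.mul_rpow (by positivity) hD0.le]; ring
  have hDpow : D ^ ((3 : ℝ) / 2 + ε) = √D * D * D ^ ε := by
    rw [Real.rpow_add hD0, show (3 : ℝ) / 2 = 1 / 2 + 1 by norm_num, Real.rpow_add hD0,
      Real.rpow_one, Real.sqrt_eq_rpow]
  have hJ2 : (J.card : ℝ) ≤ c₁ * (A * D ^ ((3 : ℝ) / 2 + ε) / P ^ 3) := by
    calc (J.card : ℝ) ≤ (c * M ^ (ε / 6)) * (1344 * A * (S / P) ^ 2) :=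
          hJ1.trans (by gcongr)
      _ = (c * M ^ (ε / 6)) * (1344 * 16 * (A * (A * C)) * P / P ^ 3) := by
          rw [div_pow, hS2]; field_simp
      _ ≤ (c * (200000 ^ (ε / 6) * (4 / 3) ^ ε * D ^ ε)) *
            (1344 * 16 * (A * (4 / 3 * D)) * √D / P ^ 3) := by gcongr
      _ = _ := by rw [hDpow, hc₁]; ring
  have hX : 0 ≤ A * D ^ ((3 : ℝ) / 2 + ε) / P ^ 3 := by positivity
  have hY : 0 ≤ C / P := by positivity
  nlinarith [mul_nonneg hc₁0.le hY]

theorem PCong.dvd_of_mul_sub_eq {p k : ℕ} (hp : p.Prime) {a b : ℚ} (h : PCong p k a b) {m z : ℤ}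
    (hm : ¬ (p : ℤ) ∣ m) (hz : m * (a - b) = z) : (p : ℤ) ^ k ∣ z := by
  have := Fact.mk hp
  rw [padicValInt_dvd_iff]
  rcases h with rfl | h
  · left
    simpa [eq_comm] using hz
  refine or_iff_not_imp_left.mpr fun hz0 => ?_
  have hm0 : (m : ℚ) ≠ 0 := by
    rintro h0
    exact hm (by simp [Int.cast_eq_zero.mp h0])
  have hab : a - b ≠ 0 := by
    intro h0
    rw [h0, mul_zero] at hz
    exact hz0 (by exact_mod_cast hz.symm)
  have hv := padicValRat.mul (p := p) hm0 hab
  rw [hz, padicValRat.of_int, padicValRat.of_int, padicValInt.eq_zero_of_not_dvd hm] at hv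
  zify
  rw [hv]
  simpa using h

theorem Nat.Prime.not_dvd_two_int {p : ℕ} (hp : p.Prime) (hp2 : p ≠ 2) : ¬ (p : ℤ) ∣ 2 := by
  intro h
  exact hp2 ((Nat.prime_dvd_prime_iff_eq hp Nat.prime_two).mp (by exact_mod_cast h))

theorem Nat.Prime.not_dvd_four_int {p : ℕ} (hp : p.Prime) (hp2 : p ≠ 2) : ¬ (p : ℤ) ∣ 4 := by
  intro h
  rw [show (4 : ℤ) = 2 * 2 by norm_num] at h
  rcases (Nat.prime_iff_prime_int.mp hp).dvd_or_dvd h with h | h <;>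
    exact hp.not_dvd_two_int hp2 h

theorem IsIntegralPosDefForm.exists_int_eq_det {n : ℕ} {M : Matrix (Fin n) (Fin n) ℚ}
    (hM : IsIntegralPosDefForm M) : ∃ δ : ℤ, (δ : ℚ) = 2 ^ n * M.det := by
  choose N hN using hM.2.2.1
  refine ⟨(Matrix.of N).det, ?_⟩
  rw [← eq_intCast (Int.castRingHom ℚ), RingHom.map_det]
  have : (Int.castRingHom ℚ).mapMatrix (Matrix.of N) = (2 : ℚ) • M := by
    ext i j
    simp [hN]
  rw [this, Matrix.det_smul, Fintype.card_fin]

theorem IsIntegralPosDefForm.det_pos {n : ℕ} {M : Matrix (Fin n) (Fin n) ℚ}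
    (hM : IsIntegralPosDefForm M) : 0 < M.det := by
  have hne : M.det ≠ 0 := by
    intro h
    obtain ⟨v, hv, hv0⟩ := Matrix.exists_mulVec_eq_zero_iff.mpr h
    have := hM.2.2.2 v hv
    simp [hv0] at this
  refine lt_of_le_of_ne ?_ hne.symm
  have hps : ((Rat.castHom ℝ).mapMatrix M).PosSemidef := by
    refine Matrix.PosSemidef.of_dotProduct_mulVec_nonneg ?_ fun v => ?_
    · ext i j
      simpa using hM.1.apply i j
    · rw [star_trivial]
      refine (DenseRange.piMap fun _ : Fin n => Rat.denseRange_cast (𝕜 := ℝ)).induction_on v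
        ?_ fun w => ?_
      · exact isClosed_le continuous_const
          (continuous_id.dotProduct (continuous_const.matrix_mulVec continuous_id))
      · have hw : 0 ≤ w ⬝ᵥ M.mulVec w := by
          rcases eq_or_ne w 0 with rfl | h
          · simp
          · exact (hM.2.2.2 w h).le
        have : ((w ⬝ᵥ M.mulVec w : ℚ) : ℝ) = Pi.map (fun _ : Fin n => ((↑) : ℚ → ℝ)) w ⬝ᵥ
            ((Rat.castHom ℝ).mapMatrix M).mulVec (Pi.map (fun _ : Fin n => ((↑) : ℚ → ℝ)) w) := by
          simp [dotProduct, Matrix.mulVec]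
        rw [← this]
        exact_mod_cast hw
  have := hps.det_nonneg
  rw [← RingHom.map_det] at this
  exact Rat.cast_nonneg.mp this

theorem SMem.sMemInt {MQ : Matrix (Fin 4) (Fin 4) ℚ} {δ A B C : ℤ} {p n : ℕ} (hp : p.Prime)
    (hp2 : p ≠ 2) (hδ : (δ : ℚ) = 2 ^ 4 * MQ.det) {x : Fin 5 → ℚ} {y : Fin 5 → ℤ}
    (hxy : ∀ i, 2 * x i = y i) (h : SMem MQ A B C p n (x 0) (x 1) (x 2) (x 3) (x 4)) :
    SMemInt δ A B C p (4 * n) y := by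
  have hx (i) : x i = y i / 2 := by rw [← hxy]; ring
  obtain ⟨-, -, -, -, -, hE, h1, h4, h2, h3, hd, hAC, hBC, hAB, hb1, hb2⟩ := h
  simp only [hx] at *
  have h2p := hp.not_dvd_two_int hp2
  have habs {z T : ℤ} (h : |(z : ℚ) / 2| ≤ T) : |z| ≤ 2 * T := by
    rw [abs_div, abs_two, div_le_iff₀ two_pos] at h
    rw [mul_comm]
    exact_mod_cast h
  have hsq {z : ℤ} (h : ((z : ℚ) / 2) ^ 2 ≤ A * C) : z ^ 2 ≤ 4 * (A * C) := by
    have : (z : ℚ) ^ 2 ≤ 4 * (A * C) := by linarith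
    exact_mod_cast this
  refine ⟨?_, habs h1, habs h4, hsq h2, hsq h3, ?_, ?_, ?_, ?_, ?_⟩
  · qify
    rw [hδ]
    linear_combination 64 * hE
  · refine hd.dvd_of_mul_sub_eq hp (hp.not_dvd_four_int hp2) ?_
    push_cast
    ring
  · refine hAC.dvd_of_mul_sub_eq hp h2p ?_
    push_cast
    ring
  · refine hBC.dvd_of_mul_sub_eq hp h2p ?_
    push_cast
    ring
  · refine hAB.dvd_of_mul_sub_eq hp h2p ?_
    push_cast
    ring
  · rintro σ (rfl | rfl) h
    · obtain ⟨a, b, c⟩ := hb1 (Or.inl (by rw [h]; push_cast; ring))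
      refine ⟨?_, ?_, ?_⟩ <;> qify <;> linarith
    · obtain ⟨a, b, c⟩ := hb2 (Or.inl (by rw [h]; push_cast; ring))
      refine ⟨?_, ?_, ?_⟩ <;> qify <;> linarith

/-- Fix a positive definite integral quaternary form `Q` and an odd prime
`p`.  For every `ε > 0` there is a constant `κ = κ(Q, p, ε)` such that for every primitive
Minkowski-reduced positive definite integral binary form `q = ⟨A,B,C⟩` of discriminant `D`
with `v_p(D) = 0` and every `n` with `p^(4n) ≤ √D` and `p^(4n) > 2A`:
`#𝒮(n) ≤ κ·(A·D^(3/2+ε)·p^(−12n) + C·p^(−4n))`. -/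
theorem SSet_card_small_minimum
    (MQ : Matrix (Fin 4) (Fin 4) ℚ) (hQ : IsIntegralPosDefForm MQ)
    (p : ℕ) (hp : p.Prime) (hp2 : p ≠ 2) (ε : ℝ) (hε : 0 < ε) :
    ∃ κ : ℝ, ∀ A B C : ℤ, 0 < A → |B| ≤ A → A ≤ C →
      0 < (A : ℚ) * C - (B : ℚ) ^ 2 / 4 →
      Int.gcd (Int.gcd A B) C = 1 →
      padicValRat p ((A : ℚ) * C - (B : ℚ) ^ 2 / 4) = 0 →
      ∀ n : ℕ,
        (p : ℝ) ^ (4 * n) ≤ Real.sqrt (((A : ℚ) * C - (B : ℚ) ^ 2 / 4 : ℚ) : ℝ) →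
        2 * (A : ℝ) < (p : ℝ) ^ (4 * n) →
        ((SSetQ MQ A B C p n).ncard : ℝ) ≤
          κ * ((A : ℝ) * (((A : ℚ) * C - (B : ℚ) ^ 2 / 4 : ℚ) : ℝ) ^ ((3 : ℝ) / 2 + ε) /
                (p : ℝ) ^ (12 * n) +
              (C : ℝ) / (p : ℝ) ^ (4 * n)) := by
  obtain ⟨δ, hδ⟩ := hQ.exists_int_eq_det
  have hδ0 : 0 < δ := by
    have := hQ.det_pos
    rw [← Int.cast_pos (R := ℚ), hδ]
    positivity
  obtain ⟨κ, hκ0, hκ⟩ := exists_card_SMemInt_le hδ0 hp hp2 hε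
  refine ⟨κ, fun A B C hA hBA hAC hD _ hpD n hn _ => ?_⟩
  set D : ℚ := (A : ℚ) * C - (B : ℚ) ^ 2 / 4 with hDdef
  have h4D : ((4 * A * C - B ^ 2 : ℤ) : ℚ) = 4 * D := by rw [hDdef]; push_cast; ring
  have hpD' : ¬ (p : ℤ) ∣ 4 * A * C - B ^ 2 := by
    have := Fact.mk hp
    have h4 : padicValRat p ((4 : ℤ) : ℚ) = 0 := by
      rw [padicValRat.of_int, padicValInt.eq_zero_of_not_dvd (hp.not_dvd_four_int hp2),
        Nat.cast_zero]
    have hv := padicValRat.mul (p := p) (q := ((4 : ℤ) : ℚ)) (by norm_num) hD.ne'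
    rw [h4, Int.cast_ofNat, ← h4D, padicValRat.of_int, hpD, add_zero, Nat.cast_eq_zero] at hv
    intro h
    rw [← pow_one (p : ℤ), padicValInt_dvd_iff, hv] at h
    rcases h with h | h
    · rw [h, Int.cast_zero] at h4D
      linarith
    · omega
  have hD' : (0 : ℝ) < D := by exact_mod_cast hD
  have hA' : (0 : ℝ) < A := by exact_mod_cast hA
  have hC' : (0 : ℝ) < C := by exact_mod_cast hA.trans_le hAC
  by_cases hfin : (SSetQ MQ A B C p n).Finite
  swap
  · rw [Set.Infinite.ncard hfin, Nat.cast_zero]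
    positivity
  let g : (Fin 5 → ℚ) → Fin 5 → ℤ := fun x i => ⌊2 * x i⌋
  have hg {x : Fin 5 → ℚ} (hx : x ∈ SSetQ MQ A B C p n) (i : Fin 5) : 2 * x i = g x i := by
    obtain ⟨⟨z0, h0⟩, ⟨z1, h1⟩, ⟨z2, h2⟩, ⟨z3, h3⟩, ⟨z4, h4⟩, -⟩ := hx
    fin_cases i <;> simp [g, *]
  have hinj : Set.InjOn g hfin.toFinset := by
    intro x hx x' hx' he
    funext i
    have h1 := hg (hfin.mem_toFinset.mp hx) i
    have h2 := hg (hfin.mem_toFinset.mp hx') i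
    rw [he] at h1
    linarith
  have key := hκ A B C (4 * n) D hA hBA hAC (by exact_mod_cast congrArg (Rat.cast (K := ℝ)) h4D)
    hpD' hn (hfin.toFinset.image g) (by
      intro y hy
      obtain ⟨x, hx, rfl⟩ := Finset.mem_image.mp hy
      rw [hfin.mem_toFinset] at hx
      exact SMem.sMemInt hp hp2 hδ (hg hx) hx)
  rwa [Finset.card_image_of_injOn hinj, ← Set.ncard_eq_toFinset_card _ hfin, ← pow_mul,
    show 4 * n * 3 = 12 * n by ring] at key
end
end

section
/- Let A,B,C ∈ ℝ with A > 0 and D = A·C − B²/4 > 0, and let Q1, Q2 be the associated polynomial functions on ℝ⁴. Let P ⊆ ℝ⁴ be a real affine plane and let α, β ∈ ℝ. If the function Q1 + α·Q2 + β vanishes identically on P, then α = 1/(4D) or β = D. -/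
/-- A vector orthogonal to a totally isotropic plane in a four-dimensional space with a
nondegenerate bilinear form lies in that plane. -/
theorem mem_of_mem_orthogonal_of_isotropic_plane {K V : Type*} [Field K] [AddCommGroup V]
    [Module K V] [FiniteDimensional K V] (hV : Module.finrank K V = 4)
    {b : LinearMap.BilinForm K V} (hb : b.Nondegenerate)
    {W : Submodule K V} (hW : Module.finrank K W = 2) (hiso : W ≤ b.orthogonal W)
    {u : V} (hu : u ∈ b.orthogonal W) : u ∈ W := by
  have hdim := LinearMap.BilinForm.finrank_orthogonal hb W
  have heq : W = b.orthogonal W := Submodule.eq_of_le_of_finrank_eq hiso (by omega)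
  rwa [heq]

/-- The polar form of `Q1 + α·Q2 + β`, written through the identity
`Q2 = ℓ² − 4D·(x1·x4 − (x2+x3)²/4)` with `ℓ = C·x1 + A·x4 − (B/2)·(x2+x3)`. -/
noncomputable def planePolarForm (A B C α : ℝ) : LinearMap.BilinForm ℝ (Fin 4 → ℝ) :=
  LinearMap.mk₂ ℝ
    (fun x y => x 0 * y 3 + x 3 * y 0 - x 1 * y 2 - x 2 * y 1 +
      α * (2 * (C * x 0 + A * x 3 - B / 2 * (x 1 + x 2)) *
          (C * y 0 + A * y 3 - B / 2 * (y 1 + y 2)) -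
        4 * (A * C - B ^ 2 / 4) *
          (x 0 * y 3 + x 3 * y 0 - (x 1 + x 2) * (y 1 + y 2) / 2)))
    (fun x x' y => by simp only [Pi.add_apply]; ring)
    (fun c x y => by simp only [Pi.smul_apply, smul_eq_mul]; ring)
    (fun x y y' => by simp only [Pi.add_apply]; ring)
    (fun c x y => by simp only [Pi.smul_apply, smul_eq_mul]; ring)

theorem planePolarForm_apply (A B C α : ℝ) (x y : Fin 4 → ℝ) :
    planePolarForm A B C α x y = x 0 * y 3 + x 3 * y 0 - x 1 * y 2 - x 2 * y 1 +
      α * (2 * (C * x 0 + A * x 3 - B / 2 * (x 1 + x 2)) *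
          (C * y 0 + A * y 3 - B / 2 * (y 1 + y 2)) -
        4 * (A * C - B ^ 2 / 4) *
          (x 0 * y 3 + x 3 * y 0 - (x 1 + x 2) * (y 1 + y 2) / 2)) :=
  rfl

theorem planePolarForm_isSymm (A B C α : ℝ) : (planePolarForm A B C α).IsSymm :=
  ⟨fun x y => by simp only [planePolarForm_apply]; ring⟩

theorem planePolarForm_nondegenerate {A B C α : ℝ} (hα : 1 - 4 * (A * C - B ^ 2 / 4) * α ≠ 0) :
    (planePolarForm A B C α).Nondegenerate := by
  refine (planePolarForm_isSymm A B C α).isRefl.nondegenerate_iff_separatingLeft.2 ?_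
  intro x hx
  have h0 := hx ![1, 0, 0, 0]
  have h1 := hx ![0, 1, 0, 0]
  have h2 := hx ![0, 0, 1, 0]
  have h3 := hx ![0, 0, 0, 1]
  simp only [planePolarForm_apply, Matrix.cons_val] at h0 h1 h2 h3
  have hl : C * x 0 + A * x 3 - B / 2 * (x 1 + x 2) = 0 := by
    linear_combination A * h0 + C * h3 + B / 2 * (h1 + h2)
  have e0 : x 0 = 0 := (mul_eq_zero_iff_left hα).1 (by
    linear_combination h3 - 2 * α * A * hl)
  have e3 : x 3 = 0 := (mul_eq_zero_iff_left hα).1 (by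
    linear_combination h0 - 2 * α * C * hl)
  have hs : x 1 + x 2 = 0 := (mul_eq_zero_iff_left hα).1 (by
    linear_combination -h1 - h2 - 2 * α * B * hl)
  have hd : x 1 - x 2 = 0 := by linear_combination h1 - h2
  ext i
  fin_cases i
  · exact e0
  · change x 1 = 0; linarith
  · change x 2 = 0; linarith
  · exact e3


/-- Let `A, B, C : ℝ` with `A > 0` and `D = A·C − B²/4 > 0`, and let
`Q1 = x1·x4 − x2·x3 − D` and
`Q2 = (C·x1 − A·x4)² + (B·x1 − A·(x2+x3))·(B·x4 − C·(x2+x3))` on `ℝ⁴`.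
If `Q1 + α·Q2 + β` vanishes identically on a real affine plane `P`, then `α = 1/(4D)` or
`β = D`.  (Coordinates: `x1 = x 0`, `x2 = x 1`, `x3 = x 2`, `x4 = x 3`.) -/
theorem vanishing_on_plane_forces_alpha_or_beta
    (A B C : ℝ) (hA : 0 < A) (hD : 0 < A * C - B ^ 2 / 4)
    (u v1 v2 : Fin 4 → ℝ) (hv : LinearIndependent ℝ ![v1, v2]) (α β : ℝ)
    (hvan : ∀ s1 s2 : ℝ,
      (fun x : Fin 4 → ℝ =>
          (x 0 * x 3 - x 1 * x 2 - (A * C - B ^ 2 / 4)) +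
            α * ((C * x 0 - A * x 3) ^ 2 +
              (B * x 0 - A * (x 1 + x 2)) * (B * x 3 - C * (x 1 + x 2))) + β)
        (u + s1 • v1 + s2 • v2) = 0) :
    α = 1 / (4 * (A * C - B ^ 2 / 4)) ∨ β = A * C - B ^ 2 / 4 := by
  by_cases hα : 1 - 4 * (A * C - B ^ 2 / 4) * α = 0
  · left
    rw [eq_div_iff (by positivity)]
    linarith
  right
  set b := planePolarForm A B C α with hb
  have hsymm : b.IsSymm := planePolarForm_isSymm A B C α
  have hval : ∀ s t : ℝ, b (u + s • v1 + t • v2) (u + s • v1 + t • v2) =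
      2 * ((A * C - B ^ 2 / 4) - β) := fun s t => by
    have h := hvan s t
    rw [hb, planePolarForm_apply]
    linear_combination 2 * h
  have hexp : ∀ s t : ℝ, b u u + s ^ 2 * b v1 v1 + t ^ 2 * b v2 v2 + 2 * s * b v1 u +
      2 * t * b v2 u + 2 * s * t * b v1 v2 = 2 * ((A * C - B ^ 2 / 4) - β) := fun s t => by
    have h1 : b u v1 = b v1 u := hsymm.eq u v1
    have h2 : b u v2 = b v2 u := hsymm.eq u v2
    have h3 : b v2 v1 = b v1 v2 := hsymm.eq v2 v1
    rw [← hval s t]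
    simp only [map_add, map_smul, LinearMap.add_apply, LinearMap.smul_apply, smul_eq_mul, h1, h2,
      h3]
    ring
  have h00 := hexp 0 0
  have h10 := hexp 1 0
  have h10' := hexp (-1) 0
  have h01 := hexp 0 1
  have h01' := hexp 0 (-1)
  have h11 := hexp 1 1
  have b11 : b v1 v1 = 0 := by linarith
  have b22 : b v2 v2 = 0 := by linarith
  have b1u : b v1 u = 0 := by linarith
  have b2u : b v2 u = 0 := by linarith
  have b12 : b v1 v2 = 0 := by linarith
  have b21 : b v2 v1 = 0 := (hsymm.eq v1 v2).symm.trans b12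
  have horth : ∀ x : Fin 4 → ℝ, b v1 x = 0 → b v2 x = 0 →
      x ∈ b.orthogonal (Submodule.span ℝ {v1, v2}) := fun x h1 h2 y hy => by
    obtain ⟨s, t, rfl⟩ := Submodule.mem_span_pair.1 hy
    simp [h1, h2]
  have hW : Module.finrank ℝ (Submodule.span ℝ {v1, v2}) = 2 := by
    have h := finrank_span_eq_card hv
    rwa [Matrix.range_cons_cons_empty, Fintype.card_fin] at h
  have hiso : Submodule.span ℝ {v1, v2} ≤ b.orthogonal (Submodule.span ℝ {v1, v2}) := by
    rw [Submodule.span_le]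
    rintro x (rfl | rfl)
    · exact horth _ b11 b21
    · exact horth _ b12 b22
  have hu : u ∈ Submodule.span ℝ {v1, v2} :=
    mem_of_mem_orthogonal_of_isotropic_plane (by simp) (planePolarForm_nondegenerate hα) hW hiso (horth u b1u b2u)
  have huu : b u u = 0 := horth u b1u b2u u hu
  linarith
end
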